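/- arXiv:2401.15406 — 5 statements merged into one kernel-verified Lean document; each statement's English description precedes it below -/
import Mathlib

section
/- Let N ≥ 2 be an integer and let 1 ≤ p < N. Then for every u ∈ C_c^∞(ℝ^N) one has ∫_{ℝ^N} |u(x)|^p / ‖x‖^p dx ≤ (p/(N−p))^p ∫_{ℝ^N} ‖∇u(x)‖^p dx. -/
open MeasureTheory

/-- A compactly supported `C¹` function is controlled by its derivative along the ray through the
point. -/
theorem enorm_le_enorm_mul_lintegral_fderiv_smul {E F : Type*}
    [NormedAddCommGroup E] [NormedSpace ℝ E] [NormedAddCommGroup F] [NormedSpace ℝ F]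
    {u : E → F} (hu : ContDiff ℝ 1 u) (hsupp : HasCompactSupport u) {x : E} (hx : x ≠ 0) :
    ‖u x‖ₑ ≤ ∫⁻ t in Set.Ioi (1 : ℝ), ‖fderiv ℝ u (t • x)‖ₑ * ‖x‖ₑ := by
  set f : ℝ → F := fun s => u (s • -x) with hf
  have hfC : ContDiff ℝ 1 f := by fun_prop
  have hfs : HasCompactSupport f :=
    hsupp.comp_isClosedEmbedding (isClosedEmbedding_smul_left (neg_ne_zero.2 hx))
  have hd : ∀ s, ‖deriv f s‖ₑ ≤ ‖fderiv ℝ u (-s • x)‖ₑ * ‖x‖ₑ := by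
    intro s
    have h1 : HasDerivAt (fun s : ℝ => s • -x) (-x) s := by
      simpa using (hasDerivAt_id s).smul_const (-x)
    have h2 := ((hu.differentiable one_ne_zero (s • -x)).hasFDerivAt).comp_hasDerivAt s h1
    have h3 : deriv f s = fderiv ℝ u (s • -x) (-x) := h2.deriv
    rw [h3, smul_neg, ← neg_smul]
    simpa using (fderiv ℝ u (-s • x)).le_opENorm (-x)
  calc ‖u x‖ₑ = ‖f (-1)‖ₑ := by simp [hf]
    _ ≤ ∫⁻ s in Set.Iic (-1 : ℝ), ‖deriv f s‖ₑ := HasCompactSupport.enorm_le_lintegral_Ici_deriv hfC hfs _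
    _ ≤ ∫⁻ s in Set.Iic (-1 : ℝ), ‖fderiv ℝ u (-s • x)‖ₑ * ‖x‖ₑ := lintegral_mono hd
    _ = ∫⁻ t in Set.Ici (1 : ℝ), ‖fderiv ℝ u (t • x)‖ₑ * ‖x‖ₑ := by
      have := (Measure.measurePreserving_neg (volume : Measure ℝ)).setLIntegral_comp_preimage_emb
        (Homeomorph.neg ℝ).measurableEmbedding
        (fun t => ‖fderiv ℝ u (t • x)‖ₑ * ‖x‖ₑ) (Set.Ici 1)
      simpa using this
    _ = _ := setLIntegral_congr Ioi_ae_eq_Ici.symm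

/-- **Jensen's inequality** for `t ↦ t ^ p` and a probability density `w`. -/
theorem lintegral_rpow_le_lintegral_rpow_mul_of_lintegral_eq_one {α : Type*} [MeasurableSpace α]
    {μ : Measure α} {w g : α → ENNReal} (hw : Measurable w) (hg : Measurable g)
    (hw1 : ∫⁻ a, w a ∂μ = 1) (hw0 : ∀ᵐ a ∂μ, w a ≠ 0) {p : ℝ} (hp : 1 ≤ p) :
    (∫⁻ a, g a ∂μ) ^ p ≤ ∫⁻ a, w a ^ (1 - p) * g a ^ p ∂μ := by
  have hp0 : 0 < p := by linarith
  have hwt : ∀ᵐ a ∂μ, w a < ⊤ := ae_lt_top hw (by simp [hw1])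
  have hprob : IsProbabilityMeasure (μ.withDensity w) := ⟨by simp [hw1]⟩
  have hm : Measurable fun a => (w a)⁻¹ * g a := by fun_prop
  have h := eLpNorm'_le_eLpNorm'_of_exponent_le one_pos hp (μ.withDensity w)
    hm.aestronglyMeasurable
  have h' := ENNReal.rpow_le_rpow h hp0.le
  rw [← lintegral_rpow_enorm_eq_rpow_eLpNorm' hp0, eLpNorm'_eq_lintegral_enorm] at h'
  simp only [enorm_eq_self, ENNReal.rpow_one, div_one] at h'
  rw [lintegral_withDensity_eq_lintegral_mul _ hw hm,
    lintegral_withDensity_eq_lintegral_mul _ hw (hm.pow_const p)] at h'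
  convert h' using 1
  · congr 1
    refine lintegral_congr_ae ?_
    filter_upwards [hw0, hwt] with a h0 ht
    simp [← mul_assoc, ENNReal.mul_inv_cancel h0 ht.ne]
  · refine lintegral_congr_ae ?_
    filter_upwards [hw0, hwt] with a h0 ht
    simp only [Pi.mul_apply]
    rw [ENNReal.mul_rpow_of_nonneg _ _ hp0.le, ← mul_assoc, ENNReal.inv_rpow, ← ENNReal.rpow_neg,
      sub_eq_add_neg, ENNReal.rpow_add _ _ h0 ht.ne, ENNReal.rpow_one]

theorem lintegral_comp_smul_addHaar {E : Type*} [NormedAddCommGroup E] [NormedSpace ℝ E]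
    [FiniteDimensional ℝ E] [MeasurableSpace E] [BorelSpace E] (μ : Measure E)
    [μ.IsAddHaarMeasure] {g : E → ENNReal} (hg : Measurable g) {r : ℝ} (hr : r ≠ 0) :
    ∫⁻ x, g (r • x) ∂μ = ENNReal.ofReal |(r ^ Module.finrank ℝ E)⁻¹| * ∫⁻ x, g x ∂μ := by
  rw [← lintegral_map hg (measurable_const_smul r), Measure.map_addHaar_smul μ hr,
    lintegral_smul_measure, smul_eq_mul]

theorem lintegral_Ioi_one_rpow {a : ℝ} (ha : 1 < a) :
    ∫⁻ t in Set.Ioi (1 : ℝ), ENNReal.ofReal ((a - 1) * t ^ (-a)) = 1 := by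
  rw [← ofReal_integral_eq_lintegral_ofReal
      ((integrableOn_Ioi_rpow_of_lt (by linarith) one_pos).const_mul _),
    integral_const_mul, integral_Ioi_rpow_of_lt (by linarith) one_pos]
  · have : -a + 1 ≠ 0 := by linarith
    rw [Real.one_rpow, show (a - 1) * (-1 / (-a + 1)) = 1 by field_simp; ring, ENNReal.ofReal_one]
  · filter_upwards [ae_restrict_mem measurableSet_Ioi] with t ht
    have : (0 : ℝ) < t := one_pos.trans ht
    have : 0 < a - 1 := by linarith
    positivity

/-- **Hardy's inequality** for the Lebesgue integral, on a finite-dimensional normed space. -/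
theorem lintegral_enorm_div_enorm_rpow_le {E F : Type*} [NormedAddCommGroup E] [NormedSpace ℝ E]
    [FiniteDimensional ℝ E] [MeasurableSpace E] [BorelSpace E] (μ : Measure E)
    [μ.IsAddHaarMeasure] [NormedAddCommGroup F] [NormedSpace ℝ F]
    {p : ℝ} (hp : 1 ≤ p) (hpE : p < Module.finrank ℝ E)
    {u : E → F} (hu : ContDiff ℝ 1 u) (hsupp : HasCompactSupport u) :
    ∫⁻ x, (‖u x‖ₑ / ‖x‖ₑ) ^ p ∂μ ≤
      ENNReal.ofReal ((p / (Module.finrank ℝ E - p)) ^ p) * ∫⁻ x, ‖fderiv ℝ u x‖ₑ ^ p ∂μ := by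
  set n := Module.finrank ℝ E with hn
  have hp0 : 0 < p := by linarith
  have hnp : 0 < (n : ℝ) - p := by linarith
  have : Nontrivial E := Module.finrank_pos_iff (R := ℝ) |>.1 (by
    rw [← hn]; exact_mod_cast hp0.trans hpE)
  have ha : 1 < n / p := (one_lt_div hp0).2 hpE
  have hD : Measurable fun x => ‖fderiv ℝ u x‖ₑ :=
    (hu.continuous_fderiv one_ne_zero).enorm.measurable
  have hD2 : Measurable fun z : E × ℝ => ‖fderiv ℝ u (z.2 • z.1)‖ₑ :=
    ((hu.continuous_fderiv one_ne_zero).comp (by fun_prop)).enorm.measurable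
  set w : ℝ → ENNReal := fun t => ENNReal.ofReal ((n / p - 1) * t ^ (-(n / p))) with hw
  have hwm : Measurable w := by fun_prop
  have hw1 : ∫⁻ t in Set.Ioi (1 : ℝ), w t = 1 := lintegral_Ioi_one_rpow ha
  have hwpos : ∀ t ∈ Set.Ioi (1 : ℝ), 0 < (n / p - 1) * t ^ (-(n / p)) := by
    intro t ht
    have : (0 : ℝ) < t := one_pos.trans ht
    have : 0 < n / p - 1 := by linarith
    positivity
  have hw0 : ∀ᵐ t ∂(volume.restrict (Set.Ioi (1 : ℝ))), w t ≠ 0 := by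
    filter_upwards [ae_restrict_mem measurableSet_Ioi] with t ht
    simpa [hw] using hwpos t ht
  have hweight : ∀ t ∈ Set.Ioi (1 : ℝ), w t ^ (1 - p) * ENNReal.ofReal |(t ^ n)⁻¹| =
      ENNReal.ofReal ((p / (n - p)) ^ p) * w t := by
    intro t ht
    have ht0 : (0 : ℝ) < t := one_pos.trans ht
    have hc : 0 < n / p - 1 := by linarith
    have hwt := hwpos t ht
    rw [hw]
    dsimp only
    rw [ENNReal.ofReal_rpow_of_pos hwt, ← ENNReal.ofReal_mul (by positivity),
      ← ENNReal.ofReal_mul (by positivity)]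
    congr 1
    rw [sub_eq_add_neg 1 p, Real.rpow_add hwt, Real.rpow_one, abs_of_pos (by positivity),
      Real.mul_rpow hc.le (by positivity), ← Real.rpow_mul ht0.le,
      show -(n / p) * -p = n by field_simp, Real.rpow_natCast,
      show p / (n - p) = (n / p - 1)⁻¹ by field_simp, Real.inv_rpow hc.le, Real.rpow_neg hc.le]
    field_simp
  calc ∫⁻ x, (‖u x‖ₑ / ‖x‖ₑ) ^ p ∂μ
      ≤ ∫⁻ x, (∫⁻ t in Set.Ioi (1 : ℝ), ‖fderiv ℝ u (t • x)‖ₑ) ^ p ∂μ := by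
        refine lintegral_mono_ae ?_
        filter_upwards [Measure.ae_ne μ (0 : E)] with x hx
        gcongr
        refine ENNReal.div_le_of_le_mul ?_
        rw [← lintegral_mul_const' _ _ enorm_ne_top]
        exact enorm_le_enorm_mul_lintegral_fderiv_smul hu hsupp hx
    _ ≤ ∫⁻ x, (∫⁻ t in Set.Ioi (1 : ℝ), w t ^ (1 - p) * ‖fderiv ℝ u (t • x)‖ₑ ^ p) ∂μ :=
        lintegral_mono fun x => lintegral_rpow_le_lintegral_rpow_mul_of_lintegral_eq_one hwm
          (hD.comp (measurable_id.smul_const x)) hw1 hw0 hp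
    _ = ∫⁻ t in Set.Ioi (1 : ℝ), (∫⁻ x, w t ^ (1 - p) * ‖fderiv ℝ u (t • x)‖ₑ ^ p ∂μ) := by
        refine lintegral_lintegral_swap (Measurable.aemeasurable ?_)
        exact ((hwm.comp measurable_snd).pow_const _).mul (hD2.pow_const _)
    _ = ∫⁻ t in Set.Ioi (1 : ℝ), ENNReal.ofReal ((p / (n - p)) ^ p) * w t *
          ∫⁻ x, ‖fderiv ℝ u x‖ₑ ^ p ∂μ := by
        refine setLIntegral_congr_fun measurableSet_Ioi fun t ht => ?_
        have hDt : Measurable fun x => ‖fderiv ℝ u (t • x)‖ₑ := hD.comp (measurable_const_smul t)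
        rw [lintegral_const_mul _ (hDt.pow_const p),
          lintegral_comp_smul_addHaar μ (hD.pow_const p) (one_pos.trans ht).ne', ← mul_assoc,
          hweight t ht]
    _ = _ := by
        rw [lintegral_mul_const _ (by fun_prop), lintegral_const_mul _ hwm, hw1, mul_one]

/-- **Hardy (Caffarelli–Kohn–Nirenberg) inequality.**
For `N ≥ 2`, `1 ≤ p < N` and every `u ∈ C_c^∞(ℝ^N)`,
`∫ |u|^p / ‖x‖^p ≤ (p/(N-p))^p ∫ ‖∇u‖^p`. -/
theorem hardy_inequality (N : ℕ) (hN : 2 ≤ N) (p : ℝ) (hp1 : 1 ≤ p) (hpN : p < N)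
    (u : EuclideanSpace ℝ (Fin N) → ℝ) (hu : ContDiff ℝ (⊤ : ℕ∞) u)
    (hsupp : HasCompactSupport u) :
    ∫ x : EuclideanSpace ℝ (Fin N), |u x| ^ p / ‖x‖ ^ p ≤
      (p / (N - p)) ^ p * ∫ x : EuclideanSpace ℝ (Fin N), ‖gradient u x‖ ^ p := by
  have hp0 : 0 < p := by linarith
  have hc : 0 ≤ (p / (N - p)) ^ p := by
    have : 0 < (N : ℝ) - p := by linarith
    positivity
  have hu1 : ContDiff ℝ 1 u := hu.of_le (by exact_mod_cast le_top)
  have hgrad : ∀ x, ‖gradient u x‖ = ‖fderiv ℝ u x‖ := fun x => by simp [gradient]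
  simp_rw [hgrad]
  have : Nonempty (Fin N) := ⟨⟨0, by omega⟩⟩
  have hcont := hu1.continuous_fderiv one_ne_zero
  have hint : Integrable (fun x => ‖fderiv ℝ u x‖ ^ p) := by
    refine Continuous.integrable_of_hasCompactSupport
      (hcont.norm.rpow_const fun _ => Or.inr hp0.le) ?_
    exact (hsupp.fderiv (𝕜 := ℝ)).comp_left (g := fun L => ‖L‖ ^ p) (by simp [hp0.ne'])
  have hmain := lintegral_enorm_div_enorm_rpow_le
    (volume : Measure (EuclideanSpace ℝ (Fin N))) hp1 (by simpa using hpN) hu1 hsupp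
  rw [finrank_euclideanSpace_fin] at hmain
  have hright : ∫⁻ x, ‖fderiv ℝ u x‖ₑ ^ p = ENNReal.ofReal (∫ x, ‖fderiv ℝ u x‖ ^ p) := by
    rw [ofReal_integral_eq_lintegral_ofReal hint (Filter.Eventually.of_forall fun x => by positivity)]
    refine lintegral_congr fun x => ?_
    rw [← ENNReal.ofReal_rpow_of_nonneg (norm_nonneg _) hp0.le, ofReal_norm]
  have hleft : ∫⁻ x, ENNReal.ofReal (|u x| ^ p / ‖x‖ ^ p) = ∫⁻ x, (‖u x‖ₑ / ‖x‖ₑ) ^ p := by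
    refine lintegral_congr_ae ?_
    filter_upwards [Measure.ae_ne volume (0 : EuclideanSpace ℝ (Fin N))] with x hx
    rw [← Real.div_rpow (abs_nonneg _) (norm_nonneg _),
      ← ENNReal.ofReal_rpow_of_nonneg (by positivity) hp0.le,
      ENNReal.ofReal_div_of_pos (norm_pos_iff.2 hx), ofReal_norm, ← Real.norm_eq_abs, ofReal_norm]
  have hmeas : AEStronglyMeasurable (fun x => |u x| ^ p / ‖x‖ ^ p) := by
    have := hu.continuous.measurable
    exact Measurable.aestronglyMeasurable (by fun_prop)
  rw [integral_eq_lintegral_of_nonneg_ae (Filter.Eventually.of_forall fun x => by positivity) hmeas,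
    hleft]
  refine ENNReal.toReal_le_of_le_ofReal (by positivity) ?_
  rwa [ENNReal.ofReal_mul hc, ← hright]
end

section
/- Let N ≥ 2 be an integer and let 1 ≤ p < N. If C ≥ 0 is a constant such that ∫_{ℝ^N} |u(x)|^p / ‖x‖^p dx ≤ C ∫_{ℝ^N} ‖∇u(x)‖^p dx for every u ∈ C_c^∞(ℝ^N), then C ≥ (p/(N−p))^p. In other words, (p/(N−p))^p is the optimal constant in the Hardy inequality. -/
open MeasureTheory

section LogRadial

variable {E : Type*} [NormedAddCommGroup E] [InnerProductSpace ℝ E]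

/-- Integrals of radial functions in the logarithmic variable `t = log ‖x‖`. -/
theorem integral_comp_log_norm_div_rpow [FiniteDimensional ℝ E] [Nontrivial E]
    [MeasurableSpace E] [BorelSpace E] (μ : Measure E) [μ.IsAddHaarMeasure] (f : ℝ → ℝ) (p : ℝ) :
    ∫ x : E, f (Real.log ‖x‖) / ‖x‖ ^ p ∂μ =
      Module.finrank ℝ E * μ.real (Metric.ball 0 1) *
        ∫ t : ℝ, Real.exp ((Module.finrank ℝ E - p) * t) * f t := by
  have hn : 1 ≤ Module.finrank ℝ E := Module.finrank_pos
  rw [integral_fun_norm_addHaar μ (fun r ↦ f (Real.log r) / r ^ p)]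
  have himg : Set.Ioi (0 : ℝ) = Real.exp '' Set.univ := by
    rw [Set.image_univ, Real.range_exp]
  rw [himg, integral_image_eq_integral_abs_deriv_smul MeasurableSet.univ
    (fun x _ ↦ (Real.hasDerivAt_exp x).hasDerivWithinAt) Real.exp_injective.injOn,
    setIntegral_univ, nsmul_eq_mul, smul_eq_mul, mul_assoc]
  congr 2
  refine integral_congr_ae (.of_forall fun t ↦ ?_)
  simp only [smul_eq_mul, Real.log_exp, Real.abs_exp]
  rw [← Real.exp_nat_mul, ← Real.exp_mul, div_eq_mul_inv, ← Real.exp_neg, Nat.cast_sub hn,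
    show (Module.finrank ℝ E - p) * t =
      t + ((Module.finrank ℝ E : ℝ) - (1 : ℕ)) * t + -(t * p) by push_cast; ring,
    Real.exp_add, Real.exp_add]
  ring

theorem contDiff_comp_log_norm {ψ : ℝ → ℝ} (hψ : ContDiff ℝ (⊤ : ℕ∞) ψ)
    (hs : HasCompactSupport ψ) (h0 : ψ 0 = 0) :
    ContDiff ℝ (⊤ : ℕ∞) (fun x : E ↦ ψ (Real.log ‖x‖)) := by
  rw [contDiff_iff_contDiffAt]
  intro x
  rcases eq_or_ne x 0 with rfl | hx
  · have hev : (fun x : E ↦ ψ (Real.log ‖x‖)) =ᶠ[nhds 0] fun _ ↦ 0 := by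
      obtain ⟨R, hR⟩ := hs.isCompact.isBounded.subset_closedBall 0
      filter_upwards [Metric.ball_mem_nhds (0 : E) (Real.exp_pos (-R))] with y hy
      rcases eq_or_ne y 0 with rfl | hy0
      · simp [h0]
      · apply image_eq_zero_of_notMem_tsupport
        intro hmem
        have h1 := hR hmem
        rw [mem_closedBall_zero_iff, Real.norm_eq_abs] at h1
        rw [mem_ball_zero_iff, ← Real.log_lt_iff_lt_exp (norm_pos_iff.2 hy0)] at hy
        linarith [(abs_le.1 h1).1]
    exact contDiffAt_const.congr_of_eventuallyEq hev
  · exact hψ.contDiffAt.comp x ((contDiffAt_norm ℝ hx).log (norm_ne_zero_iff.2 hx))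

theorem hasCompactSupport_comp_log_norm [FiniteDimensional ℝ E] {ψ : ℝ → ℝ}
    (hs : HasCompactSupport ψ) : HasCompactSupport (fun x : E ↦ ψ (Real.log ‖x‖)) := by
  obtain ⟨R, hR⟩ := hs.isCompact.isBounded.subset_closedBall 0
  refine HasCompactSupport.intro (isCompact_closedBall (0 : E) (Real.exp R)) fun y hy ↦ ?_
  apply image_eq_zero_of_notMem_tsupport
  intro hmem
  have h1 := hR hmem
  rw [mem_closedBall_zero_iff, Real.norm_eq_abs] at h1
  rw [mem_closedBall_zero_iff, not_le] at hy
  rw [← Real.lt_log_iff_exp_lt ((Real.exp_pos R).trans hy)] at hy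
  linarith [(abs_le.1 h1).2]

theorem norm_gradient_comp_log_norm [CompleteSpace E] {ψ : ℝ → ℝ} (hψ : Differentiable ℝ ψ)
    {x : E} (hx : x ≠ 0) :
    ‖gradient (fun x : E ↦ ψ (Real.log ‖x‖)) x‖ = |deriv ψ (Real.log ‖x‖)| / ‖x‖ := by
  have hx' : ‖x‖ ≠ 0 := norm_ne_zero_iff.2 hx
  have hd : DifferentiableAt ℝ (fun x : E ↦ ‖x‖) x :=
    (contDiffAt_norm ℝ hx (n := 1)).differentiableAt one_ne_zero
  have h1 : HasFDerivAt (fun x : E ↦ ψ (Real.log ‖x‖))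
      (deriv ψ (Real.log ‖x‖) • (‖x‖⁻¹ • fderiv ℝ (fun x : E ↦ ‖x‖) x)) x :=
    (hψ _).hasDerivAt.comp_hasFDerivAt x (hd.hasFDerivAt.log hx')
  have : Nontrivial E := ⟨x, 0, hx⟩
  rw [gradient, LinearIsometryEquiv.norm_map, h1.fderiv, norm_smul, norm_smul,
    norm_fderiv_norm hd, mul_one, Real.norm_eq_abs, norm_inv, norm_norm, div_eq_mul_inv]

end LogRadial

/-- The weighted one-dimensional inequality obtained by testing the Hardy inequality on
functions of `log ‖x‖`. -/
theorem hardy_log_variable {N : ℕ} (hN : 2 ≤ N) {p : ℝ} {C : ℝ}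
    (h : ∀ u : EuclideanSpace ℝ (Fin N) → ℝ, ContDiff ℝ (⊤ : ℕ∞) u → HasCompactSupport u →
      ∫ x : EuclideanSpace ℝ (Fin N), |u x| ^ p / ‖x‖ ^ p ≤
        C * ∫ x : EuclideanSpace ℝ (Fin N), ‖gradient u x‖ ^ p)
    {ψ : ℝ → ℝ} (hψ : ContDiff ℝ (⊤ : ℕ∞) ψ) (hs : HasCompactSupport ψ) (h0 : ψ 0 = 0) :
    ∫ t : ℝ, Real.exp ((N - p) * t) * |ψ t| ^ p ≤
      C * ∫ t : ℝ, Real.exp ((N - p) * t) * |deriv ψ t| ^ p := by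
  have : Nontrivial (EuclideanSpace ℝ (Fin N)) :=
    Module.nontrivial_of_finrank_pos (R := ℝ) (by rw [finrank_euclideanSpace_fin]; omega)
  have key := h _ (contDiff_comp_log_norm hψ hs h0) (hasCompactSupport_comp_log_norm hs)
  have hgrad : ∫ x : EuclideanSpace ℝ (Fin N),
      ‖gradient (fun x : EuclideanSpace ℝ (Fin N) ↦ ψ (Real.log ‖x‖)) x‖ ^ p =
      ∫ x : EuclideanSpace ℝ (Fin N), |deriv ψ (Real.log ‖x‖)| ^ p / ‖x‖ ^ p := by
    refine integral_congr_ae ?_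
    filter_upwards [Measure.ae_ne volume 0] with x hx
    rw [norm_gradient_comp_log_norm (hψ.differentiable (by simp)) hx,
      Real.div_rpow (abs_nonneg _) (norm_nonneg _)]
  rw [hgrad, integral_comp_log_norm_div_rpow volume (fun t ↦ |ψ t| ^ p),
    integral_comp_log_norm_div_rpow volume (fun t ↦ |deriv ψ t| ^ p),
    finrank_euclideanSpace_fin, mul_left_comm] at key
  refine le_of_mul_le_mul_left key (mul_pos (by positivity) ?_)
  exact ENNReal.toReal_pos (Metric.measure_ball_pos _ _ one_pos).ne' measure_ball_lt_top.ne

/-- The inequality of `hardy_log_variable` on the test functions `exp (-a t) * φ (ε t)`. -/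
theorem hardy_scaled_bump {N : ℕ} (hN : 2 ≤ N) {p : ℝ} (hp : 1 ≤ p) {C : ℝ}
    (h : ∀ u : EuclideanSpace ℝ (Fin N) → ℝ, ContDiff ℝ (⊤ : ℕ∞) u → HasCompactSupport u →
      ∫ x : EuclideanSpace ℝ (Fin N), |u x| ^ p / ‖x‖ ^ p ≤
        C * ∫ x : EuclideanSpace ℝ (Fin N), ‖gradient u x‖ ^ p)
    {φ : ℝ → ℝ} (hφ : ContDiff ℝ (⊤ : ℕ∞) φ) (hs : HasCompactSupport φ) (h0 : φ 0 = 0)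
    {ε : ℝ} (hε : 0 < ε) :
    ∫ t : ℝ, |φ t| ^ p ≤ C * ∫ t : ℝ, |ε * deriv φ t - (N - p) / p * φ t| ^ p := by
  have hp0 : p ≠ 0 := by linarith
  set a : ℝ := (N - p) / p with ha
  have hap : a * p = N - p := div_mul_cancel₀ _ hp0
  let ψ : ℝ → ℝ := fun t ↦ Real.exp (-a * t) * φ (ε * t)
  have hderiv (t : ℝ) :
      deriv ψ t = Real.exp (-a * t) * (ε * deriv φ (ε * t) - a * φ (ε * t)) := by
    have h1 : HasDerivAt (fun t : ℝ ↦ Real.exp (-a * t)) (Real.exp (-a * t) * (-a * 1)) t :=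
      ((hasDerivAt_id t).const_mul (-a)).exp
    have h2 : HasDerivAt (fun t : ℝ ↦ φ (ε * t)) (deriv φ (ε * t) * (ε * 1)) t :=
      ((hφ.differentiable (by simp)) (ε * t)).hasDerivAt.comp t ((hasDerivAt_id t).const_mul ε)
    refine (h1.mul h2).deriv.trans ?_
    ring
  have hweight (t y : ℝ) :
      Real.exp ((N - p) * t) * |Real.exp (-a * t) * y| ^ p = |y| ^ p := by
    rw [abs_mul, Real.abs_exp, Real.mul_rpow (Real.exp_pos _).le (abs_nonneg _), ← Real.exp_mul,
      ← mul_assoc, ← Real.exp_add, ← hap,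
      show a * p * t + -a * t * p = 0 by ring, Real.exp_zero, one_mul]
  have hψ : ContDiff ℝ (⊤ : ℕ∞) ψ := by
    have := hφ.comp (contDiff_const.mul contDiff_id : ContDiff ℝ (⊤ : ℕ∞) fun t : ℝ ↦ ε * t)
    exact (contDiff_const.mul contDiff_id).exp.mul this
  have hψs : HasCompactSupport ψ :=
    (hs.comp_homeomorph (Homeomorph.mulLeft₀ ε hε.ne')).mul_left
  have key := hardy_log_variable hN h hψ hψs (by simp [ψ, h0])
  simp only [hderiv] at key
  simp only [ψ, hweight] at key
  rw [Measure.integral_comp_mul_left (fun t ↦ |φ t| ^ p) ε,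
    Measure.integral_comp_mul_left (fun t ↦ |ε * deriv φ t - a * φ t| ^ p) ε,
    smul_eq_mul, smul_eq_mul, mul_left_comm] at key
  exact le_of_mul_le_mul_left key (by positivity)

/-- **Optimality of the constant in the Hardy inequality.**
If `C ≥ 0` satisfies `∫ |u|^p / ‖x‖^p ≤ C ∫ ‖∇u‖^p` for every `u ∈ C_c^∞(ℝ^N)`,
then `C ≥ (p/(N-p))^p`. -/
theorem hardy_constant_optimal (N : ℕ) (hN : 2 ≤ N) (p : ℝ) (hp1 : 1 ≤ p) (hpN : p < N)
    (C : ℝ) (hC : 0 ≤ C)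
    (h : ∀ u : EuclideanSpace ℝ (Fin N) → ℝ, ContDiff ℝ (⊤ : ℕ∞) u → HasCompactSupport u →
      ∫ x : EuclideanSpace ℝ (Fin N), |u x| ^ p / ‖x‖ ^ p ≤
        C * ∫ x : EuclideanSpace ℝ (Fin N), ‖gradient u x‖ ^ p) :
    (p / (N - p)) ^ p ≤ C := by
  have hp0 : 0 < p := by linarith
  have ha : 0 < (N - p) / p := div_pos (by linarith) hp0
  let b : ContDiffBump (2 : ℝ) := ⟨1 / 2, 1, by norm_num, by norm_num⟩
  have hb : ContDiff ℝ (⊤ : ℕ∞) b := b.contDiff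
  have hb0 : b 0 = 0 := b.zero_of_le_dist (by norm_num [b, Real.dist_eq])
  have hdc : Continuous (deriv b) := hb.continuous_deriv (by simp)
  have hbc : Continuous b := hb.continuous
  have hcont : Continuous fun ε : ℝ ↦ ∫ t : ℝ, |ε * deriv b t - (N - p) / p * b t| ^ p := by
    have hK := b.hasCompactSupport.isCompact
    have : (fun ε : ℝ ↦ ∫ t : ℝ, |ε * deriv b t - (N - p) / p * b t| ^ p) =
        fun ε : ℝ ↦ ∫ t in tsupport b, |ε * deriv b t - (N - p) / p * b t| ^ p := by
      funext ε
      refine (setIntegral_eq_integral_of_forall_compl_eq_zero fun t ht ↦ ?_).symm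
      rw [image_eq_zero_of_notMem_tsupport ht,
        image_eq_zero_of_notMem_tsupport (fun h' ↦ ht (tsupport_deriv_subset h'))]
      simp [hp0.ne']
    rw [this]
    refine continuous_parametric_integral_of_continuous ?_ hK
    refine Continuous.rpow_const ?_ fun _ ↦ Or.inr hp0.le
    fun_prop
  have hlim : ∫ t : ℝ, |b t| ^ p ≤ C * ∫ t : ℝ, |0 * deriv b t - (N - p) / p * b t| ^ p := by
    refine ge_of_tendsto (((hcont.tendsto 0).const_mul C).mono_left
      (nhdsWithin_le_nhds (s := Set.Ioi 0))) ?_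
    filter_upwards [self_mem_nhdsWithin] with ε hε
    exact hardy_scaled_bump hN hp1 h hb b.hasCompactSupport hb0 hε
  have hpos : 0 < ∫ t : ℝ, |b t| ^ p := by
    have hc : Continuous fun t ↦ |b t| ^ p := hbc.abs.rpow_const fun _ ↦ Or.inr hp0.le
    refine hc.integral_pos_of_hasCompactSupport_nonneg_nonzero
      (b.hasCompactSupport.comp_left (g := fun y ↦ |y| ^ p) (by simp [hp0.ne']))
      (fun t ↦ by positivity) (x := 2) ?_
    have : b 2 = 1 := b.one_of_mem_closedBall (by simp [b])
    simp [this]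
  simp only [zero_mul, zero_sub, abs_neg, abs_mul, abs_of_pos ha,
    Real.mul_rpow ha.le (abs_nonneg _)] at hlim
  rw [integral_const_mul, ← mul_assoc] at hlim
  have h1 : 1 ≤ C * ((N - p) / p) ^ p :=
    le_of_mul_le_mul_right (by rwa [one_mul]) hpos
  rw [← inv_div, Real.inv_rpow ha.le]
  exact (inv_le_iff_one_le_mul₀ (Real.rpow_pos_of_pos ha p)).2 h1
end

section
/- Let N ≥ 2 be an integer and let ω_N denote the Lebesgue measure of the unit ball B_1(0) ⊂ ℝ^N. Then for every u ∈ C_c^∞(ℝ^N) one has ∫_0^∞ t^{−1/N} u*(t) dt ≤ γ ∫_{ℝ^N} ‖∇u(x)‖ dx, where γ = 1/((N−1) ω_N^{1/N}). (That is, ‖u‖_{L^{N/(N−1),1}} ≤ γ ∫ ‖∇u‖, with γ the best constant in this Sobolev embedding.) -/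
open MeasureTheory ENNReal

/-- The non-increasing rearrangement of a measurable function `f` on a measure space,
`f*(t) = inf {s > 0 : μ({|f| > s}) ≤ t}`, with the convention `inf ∅ = +∞`. -/
noncomputable def rearrangement {Ω : Type*} [MeasurableSpace Ω] (μ : Measure Ω)
    (f : Ω → ℝ) (t : ℝ) : ℝ≥0∞ :=
  sInf (ENNReal.ofReal '' {s : ℝ | 0 < s ∧ μ {x | s < |f x|} ≤ ENNReal.ofReal t})

open Set Pointwise

/-- A number in `ℝ≥0∞` as the length of the interval below it. -/
theorem eq_volume_restrict_ofReal_lt (c : ℝ≥0∞) :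
    c = volume.restrict (Ioi (0 : ℝ)) {s : ℝ | ENNReal.ofReal s < c} := by
  rw [Measure.restrict_apply (measurableSet_lt (by fun_prop) (by fun_prop))]
  rcases eq_or_ne c ∞ with rfl | hc
  · simp
  · have : {s : ℝ | ENNReal.ofReal s < c} ∩ Ioi 0 = Ioo 0 c.toReal := by
      ext s
      simp only [mem_inter_iff, mem_ofPred_eq, mem_Ioi, mem_Ioo]
      exact ⟨fun h ↦ ⟨h.2, (ENNReal.ofReal_lt_iff_lt_toReal h.2.le hc).1 h.1⟩,
        fun h ↦ ⟨(ENNReal.ofReal_lt_iff_lt_toReal h.1.le hc).2 h.2, h.1⟩⟩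
    rw [this, Real.volume_Ioo, sub_zero, ENNReal.ofReal_toReal hc]

/-- Layer cake formula for functions with values in `ℝ≥0∞`. -/
theorem lintegral_eq_lintegral_meas_ofReal_lt {α : Type*} [MeasurableSpace α] (μ : Measure α)
    [SFinite μ] {f : α → ℝ≥0∞} (hf : Measurable f) :
    ∫⁻ x, f x ∂μ = ∫⁻ s in Ioi (0 : ℝ), μ {x | ENNReal.ofReal s < f x} := by
  have hmeas : MeasurableSet {z : α × ℝ | ENNReal.ofReal z.2 < f z.1} :=
    measurableSet_lt (by fun_prop) (by fun_prop)
  calc ∫⁻ x, f x ∂μ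
      = ∫⁻ x, (volume.restrict (Ioi (0 : ℝ))) (Prod.mk x ⁻¹' {z | ENNReal.ofReal z.2 < f z.1}) ∂μ :=
        lintegral_congr fun x ↦ eq_volume_restrict_ofReal_lt (f x)
    _ = _ := by
        rw [← Measure.prod_apply hmeas, Measure.prod_apply_symm hmeas]
        rfl

/-- The one-dimensional Brunn-Minkowski inequality. -/
theorem Real.volume_add_volume_le {A B C : Set ℝ} (hA : MeasurableSet A) (hB : MeasurableSet B)
    (hA₀ : A.Nonempty) (hB₀ : B.Nonempty) (hC : ∀ a ∈ A, ∀ b ∈ B, a + b ∈ C) :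
    volume A + volume B ≤ volume C := by
  have hcompact {K L : Set ℝ} (hK : IsCompact K) (hL : IsCompact L) (hK₀ : K.Nonempty)
      (hL₀ : L.Nonempty) (hKA : K ⊆ A) (hLB : L ⊆ B) : volume K + volume L ≤ volume C := by
    obtain ⟨a, haK, ha⟩ := hK.exists_isGreatest hK₀
    obtain ⟨b, hbL, hb⟩ := hL.exists_isLeast hL₀
    have hdisj : AEDisjoint volume ((fun x ↦ x + b) '' K) ((fun x ↦ a + x) '' L) := by
      refine measure_mono_null (t := {a + b}) ?_ (by simp)
      rintro _ ⟨⟨x, hx, rfl⟩, y, hy, hxy⟩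
      have h₁ := ha hx
      have h₂ := hb hy
      simp only [mem_singleton_iff] at hxy ⊢
      linarith
    calc volume K + volume L
        = volume ((fun x ↦ x + b) '' K) + volume ((fun x ↦ a + x) '' L) := by simp
      _ = volume ((fun x ↦ x + b) '' K ∪ (fun x ↦ a + x) '' L) :=
        (measure_union₀ (hL.image (by fun_prop)).measurableSet.nullMeasurableSet hdisj).symm
      _ ≤ volume C := by
        refine measure_mono (union_subset ?_ ?_)
        · rintro _ ⟨x, hx, rfl⟩
          exact hC x (hKA hx) b (hLB hbL)
        · rintro _ ⟨y, hy, rfl⟩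
          exact hC a (hKA haK) y (hLB hy)
  obtain ⟨a₀, ha₀⟩ := hA₀
  obtain ⟨b₀, hb₀⟩ := hB₀
  rw [hA.measure_eq_iSup_isCompact, hB.measure_eq_iSup_isCompact]
  simp_rw [iSup_and']
  refine ENNReal.biSup_add_biSup_le' ⟨∅, by simp⟩ ⟨∅, by simp⟩ ?_
  intro K hK L hL
  refine (add_le_add (measure_mono (subset_insert a₀ K))
    (measure_mono (subset_insert b₀ L))).trans ?_
  exact hcompact (hK.2.insert a₀) (hL.2.insert b₀) (insert_nonempty _ _) (insert_nonempty _ _)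
    (insert_subset ha₀ hK.1) (insert_subset hb₀ hL.1)

theorem ENNReal.geom_mean_le_arith_mean2_weighted {p q : ℝ} (hp : 0 < p) (hq : 0 < q)
    (hpq : p + q = 1) (a b : ℝ≥0∞) :
    a ^ p * b ^ q ≤ ENNReal.ofReal p * a + ENNReal.ofReal q * b := by
  have h := ENNReal.young_inequality (a ^ p) (b ^ q) (p := p⁻¹) (q := q⁻¹)
    ⟨by simpa using hpq, by positivity, by positivity⟩
  rw [← ENNReal.rpow_mul, ← ENNReal.rpow_mul, mul_inv_cancel₀ hp.ne', mul_inv_cancel₀ hq.ne',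
    ENNReal.rpow_one, ENNReal.rpow_one, ENNReal.ofReal_inv_of_pos hp,
    ENNReal.ofReal_inv_of_pos hq, div_eq_mul_inv, div_eq_mul_inv, inv_inv, inv_inv] at h
  rwa [mul_comm _ a, mul_comm _ b]

/-- The Prekopa-Leindler inequality with weights `p`, `q`, as a property of a measure. -/
def HasPrekopaLeindler {E : Type*} [AddCommGroup E] [Module ℝ E] [MeasurableSpace E]
    (μ : Measure E) (p q : ℝ) : Prop :=
  ∀ f g h : E → ℝ≥0∞, Measurable f → Measurable g → Measurable h →
    (∀ x y, f x ^ p * g y ^ q ≤ h (p • x + q • y)) →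
    (∫⁻ x, f x ∂μ) ^ p * (∫⁻ x, g x ∂μ) ^ q ≤ ∫⁻ x, h x ∂μ

namespace HasPrekopaLeindler

theorem prod {E F : Type*} [AddCommGroup E] [Module ℝ E] [MeasurableSpace E]
    [AddCommGroup F] [Module ℝ F] [MeasurableSpace F] {μ : Measure E} {ν : Measure F} [SFinite ν]
    {p q : ℝ} (hμ : HasPrekopaLeindler μ p q) (hν : HasPrekopaLeindler ν p q) :
    HasPrekopaLeindler (μ.prod ν) p q := by
  intro f g h hf hg hh H
  rw [lintegral_prod _ hf.aemeasurable, lintegral_prod _ hg.aemeasurable,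
    lintegral_prod _ hh.aemeasurable]
  refine hμ _ _ _ hf.lintegral_prod_right' hg.lintegral_prod_right' hh.lintegral_prod_right' ?_
  intro x y
  exact hν _ _ _ (by fun_prop) (by fun_prop) (by fun_prop) fun a b ↦ H (x, a) (y, b)

theorem of_measurePreserving {E F : Type*} [AddCommGroup E] [Module ℝ E] [MeasurableSpace E]
    [AddCommGroup F] [Module ℝ F] [MeasurableSpace F] {μ : Measure E} {ν : Measure F}
    {p q : ℝ} (hμ : HasPrekopaLeindler μ p q) (e : E ≃ᵐ F) (he : MeasurePreserving e μ ν)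
    (hlin : ∀ x y, e (p • x + q • y) = p • e x + q • e y) :
    HasPrekopaLeindler ν p q := by
  intro f g h hf hg hh H
  simp only [← he.lintegral_comp_emb e.measurableEmbedding]
  refine hμ _ _ _ (hf.comp e.measurable) (hg.comp e.measurable) (hh.comp e.measurable) ?_
  intro x y
  simpa only [Function.comp_apply, hlin] using H (e x) (e y)

theorem dirac {E : Type*} [AddCommGroup E] [Module ℝ E] [MeasurableSpace E] [Subsingleton E]
    (a : E) (p q : ℝ) : HasPrekopaLeindler (Measure.dirac a) p q := by
  intro f g h hf hg hh H
  rw [lintegral_dirac' _ hf, lintegral_dirac' _ hg, lintegral_dirac' _ hh]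
  simpa only [Subsingleton.elim (p • a + q • a) a] using H a a

end HasPrekopaLeindler

theorem lintegral_add_le_lintegral_of_le_one {p q : ℝ} (hp : 0 < p) (hq : 0 < q)
    (hpq : p + q = 1) {f g h : ℝ → ℝ≥0∞} (hf : Measurable f) (hg : Measurable g)
    (hh : Measurable h) (H : ∀ x y, f x ^ p * g y ^ q ≤ h (p • x + q • y))
    (hf₁ : ∀ x, f x ≤ 1) (hg₁ : ∀ x, g x ≤ 1) (hf₀ : ∀ s < 1, ∃ x, s < f x)
    (hg₀ : ∀ s < 1, ∃ x, s < g x) :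
    ENNReal.ofReal p * (∫⁻ x, f x) + ENNReal.ofReal q * (∫⁻ x, g x) ≤ ∫⁻ x, h x := by
  rw [lintegral_eq_lintegral_meas_ofReal_lt _ hf, lintegral_eq_lintegral_meas_ofReal_lt _ hg,
    lintegral_eq_lintegral_meas_ofReal_lt _ hh]
  have hanti (f : ℝ → ℝ≥0∞) : Measurable fun s : ℝ ↦ volume {x | ENNReal.ofReal s < f x} :=
    Antitone.measurable fun s t hst ↦
      measure_mono fun x hx ↦ (ENNReal.ofReal_le_ofReal hst).trans_lt hx
  rw [← lintegral_const_mul _ (hanti f), ← lintegral_const_mul _ (hanti g),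
    ← lintegral_add_left ((hanti f).const_mul _)]
  refine setLIntegral_mono (hanti h) fun s hs ↦ ?_
  have hs₀ : 0 < s := hs
  rcases lt_or_ge s 1 with hs₁ | hs₁
  · have hs₁' : ENNReal.ofReal s < 1 := by simpa using hs₁
    have hsmul {r : ℝ} (hr : 0 < r) (S : Set ℝ) :
        ENNReal.ofReal r * volume S = volume (r • S) := by
      simp [Measure.addHaar_smul, abs_of_pos hr]
    rw [hsmul hp, hsmul hq]
    refine Real.volume_add_volume_le ((measurableSet_lt measurable_const hf).const_smul₀ p)
      ((measurableSet_lt measurable_const hg).const_smul₀ q)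
      (Set.Nonempty.smul_set (hf₀ _ hs₁')) (Set.Nonempty.smul_set (hg₀ _ hs₁')) ?_
    rintro _ ⟨x, hx, rfl⟩ _ ⟨y, hy, rfl⟩
    refine lt_of_lt_of_le ?_ (H x y)
    calc ENNReal.ofReal s = ENNReal.ofReal s ^ p * ENNReal.ofReal s ^ q := by
          rw [← ENNReal.rpow_add _ _ (by simpa using hs₀) (by simp), hpq, ENNReal.rpow_one]
      _ < f x ^ p * g y ^ q :=
        ENNReal.mul_lt_mul (ENNReal.rpow_lt_rpow hx hp) (ENNReal.rpow_lt_rpow hy hq)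
  · have hempty {f : ℝ → ℝ≥0∞} (hf₁ : ∀ x, f x ≤ 1) : {x | ENNReal.ofReal s < f x} = ∅ := by
      ext x
      simpa using (hf₁ x).trans (by simpa using hs₁)
    simp [hempty hf₁, hempty hg₁]

theorem lintegral_rpow_mul_le_of_iSup_ne_top {p q : ℝ} (hp : 0 < p) (hq : 0 < q)
    (hpq : p + q = 1) {f g h : ℝ → ℝ≥0∞} (hf : Measurable f) (hg : Measurable g)
    (hh : Measurable h) (H : ∀ x y, f x ^ p * g y ^ q ≤ h (p • x + q • y))
    (hf₁ : ⨆ x, f x ≠ ∞) (hg₁ : ⨆ x, g x ≠ ∞) :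
    (∫⁻ x, f x) ^ p * (∫⁻ x, g x) ^ q ≤ ∫⁻ x, h x := by
  set a := ⨆ x, f x with ha
  set b := ⨆ x, g x with hb
  rcases eq_or_ne a 0 with ha₀ | ha₀
  · have : ∀ x, f x = 0 := by simpa [ha] using ha₀
    simp [this, hp]
  rcases eq_or_ne b 0 with hb₀ | hb₀
  · have : ∀ x, g x = 0 := by simpa [hb] using hb₀
    simp [this, hq]
  have hc₀ : a ^ p * b ^ q ≠ 0 := by
    simp [ha₀, hb₀, hf₁, hg₁]
  have hc₁ : a ^ p * b ^ q ≠ ∞ :=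
    ENNReal.mul_ne_top (ENNReal.rpow_ne_top_of_nonneg hp.le hf₁)
      (ENNReal.rpow_ne_top_of_nonneg hq.le hg₁)
  have hinv : (a ^ p * b ^ q)⁻¹ = a⁻¹ ^ p * b⁻¹ ^ q := by
    rw [ENNReal.mul_inv (by simp [ha₀, hf₁]) (by simp [hb₀, hg₁]), ENNReal.inv_rpow,
      ENNReal.inv_rpow]
  have hle {f : ℝ → ℝ≥0∞} {a : ℝ≥0∞} (ha : a = ⨆ x, f x) (ha₁ : a ≠ ∞) (x : ℝ) :
      a⁻¹ * f x ≤ 1 := by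
    rw [mul_comm, ← div_eq_mul_inv]
    exact ENNReal.div_le_of_le_mul (by rw [one_mul, ha]; exact le_iSup f x)
  have hex {f : ℝ → ℝ≥0∞} {a : ℝ≥0∞} (ha : a = ⨆ x, f x) (ha₀ : a ≠ 0) (ha₁ : a ≠ ∞)
      (s : ℝ≥0∞) (hs : s < 1) : ∃ x, s < a⁻¹ * f x := by
    have : s * a < ⨆ x, f x := by
      rw [← ha]
      simpa using ENNReal.mul_lt_mul_left ha₀ ha₁ hs
    obtain ⟨x, hx⟩ := lt_iSup_iff.1 this
    refine ⟨x, ?_⟩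
    rw [mul_comm, ← div_eq_mul_inv]
    exact (ENNReal.lt_div_iff_mul_lt (.inl ha₀) (.inl ha₁)).2 hx
  have key := lintegral_add_le_lintegral_of_le_one hp hq hpq (hf.const_mul a⁻¹)
    (hg.const_mul b⁻¹) (hh.const_mul (a ^ p * b ^ q)⁻¹) (fun x y ↦ by
      rw [ENNReal.mul_rpow_of_nonneg _ _ hp.le, ENNReal.mul_rpow_of_nonneg _ _ hq.le,
        mul_mul_mul_comm, hinv]
      gcongr
      exact H x y)
    (hle ha hf₁) (hle hb hg₁) (hex ha ha₀ hf₁) (hex hb hb₀ hg₁)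
  have := (ENNReal.geom_mean_le_arith_mean2_weighted hp hq hpq _ _).trans key
  rw [lintegral_const_mul _ hf, lintegral_const_mul _ hg, lintegral_const_mul _ hh,
    ENNReal.mul_rpow_of_nonneg _ _ hp.le, ENNReal.mul_rpow_of_nonneg _ _ hq.le,
    mul_mul_mul_comm, ← hinv] at this
  exact (ENNReal.mul_le_mul_iff_right (ENNReal.inv_ne_zero.2 hc₁) (ENNReal.inv_ne_top.2 hc₀)).1 this

theorem hasPrekopaLeindler_real {p q : ℝ} (hp : 0 < p) (hq : 0 < q) (hpq : p + q = 1) :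
    HasPrekopaLeindler (volume : Measure ℝ) p q := by
  intro f g h hf hg hh H
  rcases eq_or_ne (∫⁻ x, f x) 0 with hf₀ | hf₀
  · simp [hf₀, hp]
  rcases eq_or_ne (∫⁻ x, g x) 0 with hg₀ | hg₀
  · simp [hg₀, hq]
  have htendsto {f : ℝ → ℝ≥0∞} (hf : Measurable f) :
      Filter.Tendsto (fun n : ℕ ↦ ∫⁻ x, min (f x) n) Filter.atTop (nhds (∫⁻ x, f x)) := by
    refine lintegral_tendsto_of_tendsto_of_monotone
      (fun n ↦ (hf.min measurable_const).aemeasurable)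
      (.of_forall fun x m n hmn ↦ min_le_min_left _ (by exact_mod_cast hmn))
      (.of_forall fun x ↦ ?_)
    simpa using (tendsto_const_nhds (x := f x)).min ENNReal.tendsto_nat_nhds_top
  refine le_of_tendsto' (ENNReal.Tendsto.mul
    ((htendsto hf).ennrpow_const p) (.inl (by simp [hf₀, hp, hp.le]))
    ((htendsto hg).ennrpow_const q) (.inl (by simp [hg₀, hq, hq.le]))) fun n ↦ ?_
  have hsup (f : ℝ → ℝ≥0∞) : ⨆ x, min (f x) n ≠ ∞ :=
    ((iSup_le fun x ↦ min_le_right _ _).trans_lt (ENNReal.natCast_lt_top n)).ne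
  refine lintegral_rpow_mul_le_of_iSup_ne_top hp hq hpq (hf.min measurable_const)
    (hg.min measurable_const) hh (fun x y ↦ (H x y).trans' ?_) (hsup f) (hsup g)
  gcongr <;> exact min_le_left _ _

theorem hasPrekopaLeindler_pi {p q : ℝ} (hp : 0 < p) (hq : 0 < q) (hpq : p + q = 1) (n : ℕ) :
    HasPrekopaLeindler (volume : Measure (Fin n → ℝ)) p q := by
  induction n with
  | zero =>
    rw [Measure.volume_pi_eq_dirac 0]
    exact .dirac _ _ _
  | succ n ih =>
    exact ((hasPrekopaLeindler_real hp hq hpq).prod ih).of_measurePreserving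
      (MeasurableEquiv.piFinSuccAbove (fun _ : Fin (n + 1) ↦ ℝ) 0).symm
      (volume_preserving_piFinSuccAbove (fun _ : Fin (n + 1) ↦ ℝ) 0).symm fun x y ↦ by
        ext i
        refine Fin.cases ?_ (fun j ↦ ?_) i <;> simp [MeasurableEquiv.piFinSuccAbove]

theorem hasPrekopaLeindler_euclideanSpace {p q : ℝ} (hp : 0 < p) (hq : 0 < q) (hpq : p + q = 1)
    (n : ℕ) : HasPrekopaLeindler (volume : Measure (EuclideanSpace ℝ (Fin n))) p q :=
  (hasPrekopaLeindler_pi hp hq hpq n).of_measurePreserving (MeasurableEquiv.toLp 2 (Fin n → ℝ))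
    (EuclideanSpace.volume_preserving_symm_measurableEquiv_toLp (Fin n)).symm fun _ _ ↦ rfl

/-- The Brunn-Minkowski inequality for a set of volume `R ^ n * ω_n` and a ball. -/
theorem ofReal_add_pow_mul_volume_ball_le {n : ℕ} {A C : Set (EuclideanSpace ℝ (Fin n))}
    (hn : n ≠ 0) (hA : MeasurableSet A) (hCm : MeasurableSet C) {R ε : ℝ} (hR : 0 < R) (hε : 0 < ε)
    (hAR : volume A =
      ENNReal.ofReal (R ^ n) * volume (Metric.ball (0 : EuclideanSpace ℝ (Fin n)) 1))
    (hC : ∀ a ∈ A, ∀ y ∈ Metric.ball (0 : EuclideanSpace ℝ (Fin n)) ε, a + y ∈ C) :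
    ENNReal.ofReal ((R + ε) ^ n) * volume (Metric.ball (0 : EuclideanSpace ℝ (Fin n)) 1) ≤
      volume C := by
  have hRε : 0 < R + ε := by positivity
  set p := R / (R + ε) with hp
  set q := ε / (R + ε) with hq
  have hp₀ : 0 < p := by positivity
  have hq₀ : 0 < q := by positivity
  have hpq : p + q = 1 := by rw [hp, hq]; field_simp
  have : Nontrivial (EuclideanSpace ℝ (Fin n)) := by
    have := Fin.pos_iff_nonempty.1 (Nat.pos_of_ne_zero hn)
    infer_instance
  have hscale {S : Set (EuclideanSpace ℝ (Fin n))} {r ρ : ℝ} (hr : 0 < r) (hρ : 0 < ρ)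
      (hrρ : r = ρ / (R + ε)) (hS : volume S =
        ENNReal.ofReal (ρ ^ n) * volume (Metric.ball (0 : EuclideanSpace ℝ (Fin n)) 1)) :
      volume ((fun x ↦ r • x) ⁻¹' S) =
        ENNReal.ofReal ((R + ε) ^ n) * volume (Metric.ball (0 : EuclideanSpace ℝ (Fin n)) 1) := by
    rw [Measure.addHaar_preimage_smul _ hr.ne', hS, ← mul_assoc, ← ENNReal.ofReal_mul (abs_nonneg _),
      finrank_euclideanSpace_fin, abs_of_pos (by positivity), hrρ]
    congr 2
    rw [div_pow]
    field_simp
  have hA' := hscale hp₀ hR hp hAR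
  have hB' := hscale hq₀ hε hq (S := Metric.ball 0 ε) (by
    rw [Measure.addHaar_ball _ _ hε.le, finrank_euclideanSpace_fin])
  have hAm : MeasurableSet ((fun x : EuclideanSpace ℝ (Fin n) ↦ p • x) ⁻¹' A) :=
    measurable_const_smul p hA
  have hBm : MeasurableSet ((fun x : EuclideanSpace ℝ (Fin n) ↦ q • x) ⁻¹' Metric.ball 0 ε) :=
    measurable_const_smul q Metric.isOpen_ball.measurableSet
  have key := hasPrekopaLeindler_euclideanSpace hp₀ hq₀ hpq n
    (((fun x : EuclideanSpace ℝ (Fin n) ↦ p • x) ⁻¹' A).indicator 1)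
    (((fun x : EuclideanSpace ℝ (Fin n) ↦ q • x) ⁻¹' Metric.ball 0 ε).indicator 1) (C.indicator 1)
    (measurable_one.indicator hAm) (measurable_one.indicator hBm) (measurable_one.indicator hCm)
    (fun x y ↦ by
      by_cases hx : p • x ∈ A
      · by_cases hy : q • y ∈ Metric.ball (0 : EuclideanSpace ℝ (Fin n)) ε
        · have hxy := hC _ hx _ hy
          rw [indicator_of_mem (s := (fun x : EuclideanSpace ℝ (Fin n) ↦ p • x) ⁻¹' _) hx,
            indicator_of_mem (s := (fun x : EuclideanSpace ℝ (Fin n) ↦ q • x) ⁻¹' _) hy,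
            indicator_of_mem hxy]
          simp
        · rw [indicator_of_notMem (s := (fun x : EuclideanSpace ℝ (Fin n) ↦ q • x) ⁻¹' _) hy]
          simp [hq₀]
      · rw [indicator_of_notMem (s := (fun x : EuclideanSpace ℝ (Fin n) ↦ p • x) ⁻¹' _) hx]
        simp [hp₀])
  rw [lintegral_indicator_one hAm, lintegral_indicator_one hBm, lintegral_indicator_one hCm, hA',
    hB', ← ENNReal.rpow_add_of_nonneg _ _ hp₀.le hq₀.le, hpq, ENNReal.rpow_one] at key
  exact key

/-- The isoperimetric inequality, for the volume of an `ε`-enlargement. -/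
theorem volume_add_mul_volume_rpow_le {n : ℕ} (hn : 2 ≤ n)
    {A C : Set (EuclideanSpace ℝ (Fin n))} (hA : MeasurableSet A) (hCm : MeasurableSet C)
    (hA_top : volume A ≠ ∞) {ε : ℝ} (hε : 0 < ε)
    (hC : ∀ a ∈ A, ∀ y ∈ Metric.ball (0 : EuclideanSpace ℝ (Fin n)) ε, a + y ∈ C) :
    volume A + ENNReal.ofReal ε * (ENNReal.ofReal (n *
      (volume (Metric.ball (0 : EuclideanSpace ℝ (Fin n)) 1)).toReal ^ ((1 : ℝ) / n)) *
        volume A ^ (1 - (1 : ℝ) / n)) ≤ volume C := by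
  set ω := (volume (Metric.ball (0 : EuclideanSpace ℝ (Fin n)) 1)).toReal with hω
  have hω_top : volume (Metric.ball (0 : EuclideanSpace ℝ (Fin n)) 1) ≠ ∞ :=
    measure_ball_lt_top.ne
  have hω₀ : 0 < ω :=
    ENNReal.toReal_pos (Metric.measure_ball_pos _ _ one_pos).ne' hω_top
  have hn₀ : (0 : ℝ) < n := by positivity
  have hn₁ : (1 : ℝ) / n < 1 := by
    rw [div_lt_one hn₀]
    exact_mod_cast hn
  rcases eq_or_ne (volume A) 0 with hA₀ | hA₀
  · rw [hA₀, ENNReal.zero_rpow_of_pos (by linarith)]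
    simp
  set v := (volume A).toReal
  have hv₀ : 0 < v := ENNReal.toReal_pos hA₀ hA_top
  have hvA : volume A = ENNReal.ofReal v := (ENNReal.ofReal_toReal hA_top).symm
  set R := (v / ω) ^ ((1 : ℝ) / n) with hR
  have hR₀ : 0 < R := by positivity
  have hRn : R ^ n = v / ω := by
    rw [hR, one_div, Real.rpow_inv_natCast_pow (by positivity) (by positivity)]
  have key := ofReal_add_pow_mul_volume_ball_le (by positivity) hA hCm hR₀ hε (by
    rw [hRn, ← ENNReal.ofReal_toReal hω_top, ← ENNReal.ofReal_mul (by positivity), hvA]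
    congr 1
    exact (div_mul_cancel₀ v hω₀.ne').symm) hC
  refine le_trans ?_ key
  rw [← ENNReal.ofReal_toReal hω_top, ← hω, hvA, ENNReal.ofReal_rpow_of_pos hv₀,
    ← ENNReal.ofReal_mul (by positivity), ← ENNReal.ofReal_mul hε.le,
    ← ENNReal.ofReal_mul (by positivity), ← ENNReal.ofReal_add hv₀.le (by positivity)]
  refine ENNReal.ofReal_le_ofReal ?_
  have hbern : R ^ n * (1 + n * (ε / R)) ≤ (R + ε) ^ n := by
    have h := one_add_mul_le_pow (a := ε / R) (by linarith [show 0 < ε / R by positivity]) n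
    calc R ^ n * (1 + n * (ε / R)) ≤ R ^ n * (1 + ε / R) ^ n := by gcongr
      _ = (R + ε) ^ n := by
        rw [← mul_pow]
        congr 1
        field_simp
  have hωv : v / R = ω ^ ((1 : ℝ) / n) * v ^ (1 - (1 : ℝ) / n) := by
    rw [hR, Real.div_rpow hv₀.le hω₀.le, Real.rpow_sub hv₀, Real.rpow_one]
    field_simp
  calc v + ε * (n * ω ^ ((1 : ℝ) / n) * v ^ (1 - (1 : ℝ) / n))
      = R ^ n * (1 + n * (ε / R)) * ω := by
        rw [mul_assoc (n : ℝ), ← hωv, hRn]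
        field_simp
    _ ≤ (R + ε) ^ n * ω := by gcongr

theorem antitone_measure_lt_abs {Ω : Type*} [MeasurableSpace Ω] (μ : Measure Ω) (u : Ω → ℝ) :
    Antitone fun s : ℝ ↦ μ {x | s < |u x|} :=
  fun _ _ hst ↦ measure_mono fun _ hx ↦ lt_of_le_of_lt hst hx

/-- The isoperimetric inequality for superlevel sets, integrated over all levels. -/
theorem lintegral_enorm_add_mul_lintegral_rpow_le {n : ℕ} (hn : 2 ≤ n)
    {u : EuclideanSpace ℝ (Fin n) → ℝ} (hu : Measurable u)
    (hu_top : ∀ s > 0, volume {x | s < |u x|} ≠ ∞) {ε : ℝ} (hε : 0 < ε)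
    {g : EuclideanSpace ℝ (Fin n) → ℝ≥0∞} (hg : Measurable g)
    (hgu : ∀ x, ∀ y ∈ Metric.ball (0 : EuclideanSpace ℝ (Fin n)) ε, ‖u x‖ₑ ≤ g (x + y)) :
    (∫⁻ x, ‖u x‖ₑ) + ENNReal.ofReal ε * (ENNReal.ofReal (n *
      (volume (Metric.ball (0 : EuclideanSpace ℝ (Fin n)) 1)).toReal ^ ((1 : ℝ) / n)) *
        ∫⁻ s in Ioi (0 : ℝ), volume {x | s < |u x|} ^ (1 - (1 : ℝ) / n)) ≤ ∫⁻ x, g x := by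
  have hα := (antitone_measure_lt_abs volume u).measurable
  have hlevel {s : ℝ} (hs : 0 < s) :
      {x | ENNReal.ofReal s < ‖u x‖ₑ} = {x | s < |u x|} := by
    ext x
    simp only [mem_ofPred_eq, ← ofReal_norm, Real.norm_eq_abs]
    exact ENNReal.ofReal_lt_ofReal_iff_of_nonneg hs.le
  rw [lintegral_eq_lintegral_meas_ofReal_lt _ hu.enorm,
    setLIntegral_congr_fun measurableSet_Ioi fun s hs ↦ congrArg volume (hlevel hs),
    lintegral_eq_lintegral_meas_ofReal_lt _ hg, ← lintegral_const_mul _ (hα.pow_const _),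
    ← lintegral_const_mul _ ((hα.pow_const _).const_mul _), ← lintegral_add_left hα]
  refine setLIntegral_mono (Antitone.measurable fun s t hst ↦
      measure_mono fun x hx ↦ (ENNReal.ofReal_le_ofReal hst).trans_lt hx) fun s hs ↦ ?_
  refine volume_add_mul_volume_rpow_le hn (measurableSet_lt measurable_const hu.abs)
    (measurableSet_lt measurable_const hg) (hu_top s hs) hε fun x hx y hy ↦ ?_
  rw [← hlevel hs] at hx
  exact lt_of_lt_of_le hx (hgu x y hy)

theorem HasCompactSupport.measure_lt_abs_ne_top {E : Type*} [TopologicalSpace E]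
    [MeasurableSpace E] {μ : Measure E} [IsFiniteMeasureOnCompacts μ] {u : E → ℝ}
    (hu : HasCompactSupport u) {s : ℝ} (hs : 0 < s) : μ {x | s < |u x|} ≠ ∞ := by
  refine ne_top_of_le_ne_top hu.isCompact.measure_lt_top.ne (measure_mono fun x hx ↦ ?_)
  refine subset_tsupport u fun hx₀ ↦ ?_
  have : s < |u x| := hx
  rw [hx₀, abs_zero] at this
  exact hs.not_gt this

/-- On small balls, `u` is controlled by the derivative at the other point. -/
theorem exists_norm_sub_le_mul_norm_fderiv_add {E : Type*} [NormedAddCommGroup E]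
    [NormedSpace ℝ E] {u : E → ℝ} (hu : ContDiff ℝ 1 u) (hsupp : HasCompactSupport u)
    {η : ℝ} (hη : 0 < η) :
    ∃ ε > 0, ε ≤ 1 ∧ ∀ x, ∀ y ∈ Metric.ball (0 : E) ε,
      ‖u x - u (x + y)‖ ≤ ε * (‖fderiv ℝ u (x + y)‖ + η) := by
  have huc : UniformContinuous (fderiv ℝ u) :=
    (hsupp.fderiv ℝ).uniformContinuous_of_continuous (hu.continuous_fderiv one_ne_zero)
  obtain ⟨δ, hδ, hδη⟩ := Metric.uniformContinuous_iff.1 huc η hη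
  refine ⟨min δ 1, by positivity, min_le_right _ _, fun x y hy ↦ ?_⟩
  have hyε : ‖y‖ < min δ 1 := by simpa using hy
  have hbound := Convex.norm_image_sub_le_of_norm_fderiv_le (𝕜 := ℝ) (f := u)
    (C := ‖fderiv ℝ u (x + y)‖ + η) (s := Metric.ball (x + y) (min δ 1)) (x := x + y) (y := x)
    (fun z _ ↦ (hu.differentiable one_ne_zero) z) (fun z hz ↦ ?_) (convex_ball _ _)
    (Metric.mem_ball_self (by positivity)) (by simpa [dist_eq_norm] using hyε)
  · refine hbound.trans ?_
    rw [mul_comm]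
    gcongr
    simpa using hyε.le
  · have h := hδη (lt_of_lt_of_le hz (min_le_left _ _))
    rw [dist_eq_norm] at h
    linarith [norm_le_norm_add_norm_sub' (fderiv ℝ u z) (fderiv ℝ u (x + y))]

/-- The sharp Sobolev inequality in terms of the distribution function. -/
theorem mul_lintegral_measure_rpow_le_lintegral_fderiv {n : ℕ} (hn : 2 ≤ n)
    {u : EuclideanSpace ℝ (Fin n) → ℝ} (hu : ContDiff ℝ 1 u) (hsupp : HasCompactSupport u) :
    ENNReal.ofReal (n *
      (volume (Metric.ball (0 : EuclideanSpace ℝ (Fin n)) 1)).toReal ^ ((1 : ℝ) / n)) *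
        ∫⁻ s in Ioi (0 : ℝ), volume {x | s < |u x|} ^ (1 - (1 : ℝ) / n) ≤
      ∫⁻ x, ‖fderiv ℝ u x‖ₑ := by
  set K : Set (EuclideanSpace ℝ (Fin n)) := Metric.cthickening 1 (tsupport u)
  have hKc : IsCompact K := hsupp.isCompact.cthickening
  have hfderiv : Continuous (fderiv ℝ u) := hu.continuous_fderiv one_ne_zero
  have key {η : ℝ} (hη : 0 < η) : ENNReal.ofReal (n *
      (volume (Metric.ball (0 : EuclideanSpace ℝ (Fin n)) 1)).toReal ^ ((1 : ℝ) / n)) *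
        ∫⁻ s in Ioi (0 : ℝ), volume {x | s < |u x|} ^ (1 - (1 : ℝ) / n) ≤
      (∫⁻ x, ‖fderiv ℝ u x‖ₑ) + ENNReal.ofReal η * volume K := by
    obtain ⟨ε, hε, hε₁, hεu⟩ := exists_norm_sub_le_mul_norm_fderiv_add hu hsupp hη
    set g : EuclideanSpace ℝ (Fin n) → ℝ≥0∞ := fun x ↦ ‖u x‖ₑ + ENNReal.ofReal ε *
      (‖fderiv ℝ u x‖ₑ + K.indicator (fun _ ↦ ENNReal.ofReal η) x) with hg
    have hind : Measurable (K.indicator fun _ : EuclideanSpace ℝ (Fin n) ↦ ENNReal.ofReal η) :=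
      measurable_const.indicator hKc.measurableSet
    have hfK : Measurable fun x ↦
        ‖fderiv ℝ u x‖ₑ + K.indicator (fun _ ↦ ENNReal.ofReal η) x :=
      hfderiv.measurable.enorm.add hind
    have hum : Measurable fun x ↦ ‖u x‖ₑ := hu.continuous.measurable.enorm
    have hfm : Measurable fun x ↦ ‖fderiv ℝ u x‖ₑ := hfderiv.measurable.enorm
    have hgm : Measurable g := hum.add (hfK.const_mul _)
    have hmain := lintegral_enorm_add_mul_lintegral_rpow_le hn hu.continuous.measurable
      (fun s hs ↦ hsupp.measure_lt_abs_ne_top hs) hε hgm (fun x y hy ↦ by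
        by_cases hx : u x = 0
        · simp [hx]
        have hmem : x + y ∈ K := by
          refine Metric.mem_cthickening_of_dist_le (x + y) x 1 _ (subset_tsupport u hx) ?_
          have : ‖y‖ < ε := by simpa using hy
          simpa [dist_eq_norm] using this.le.trans hε₁
        simp only [hg, indicator_of_mem hmem, ← ofReal_norm]
        rw [← ENNReal.ofReal_add (norm_nonneg _) hη.le, ← ENNReal.ofReal_mul hε.le,
          ← ENNReal.ofReal_add (norm_nonneg _) (by positivity)]
        refine ENNReal.ofReal_le_ofReal ?_
        linarith [hεu x y hy, norm_le_norm_add_norm_sub' (u x) (u (x + y))])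
    simp only [hg] at hmain
    rw [lintegral_add_left hum, lintegral_const_mul _ hfK, lintegral_add_left hfm,
      lintegral_indicator_const hKc.measurableSet] at hmain
    have hu_top : ∫⁻ x, ‖u x‖ₑ ≠ ∞ :=
      (hu.continuous.integrable_of_hasCompactSupport hsupp).hasFiniteIntegral.ne
    rw [ENNReal.add_le_add_iff_left hu_top] at hmain
    exact (ENNReal.mul_le_mul_iff_right (by simpa using hε) ENNReal.ofReal_ne_top).1 hmain
  have hlim : Filter.Tendsto (fun η : ℝ ↦ (∫⁻ x, ‖fderiv ℝ u x‖ₑ) + ENNReal.ofReal η * volume K)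
      (nhdsWithin 0 (Ioi 0)) (nhds (∫⁻ x, ‖fderiv ℝ u x‖ₑ)) := by
    have h₀ : Filter.Tendsto ENNReal.ofReal (nhdsWithin 0 (Ioi 0)) (nhds 0) := by
      simpa using (ENNReal.continuous_ofReal.tendsto 0).mono_left nhdsWithin_le_nhds
    simpa using (ENNReal.Tendsto.mul_const h₀ (.inr hKc.measure_lt_top.ne)).const_add
      (∫⁻ x, ‖fderiv ℝ u x‖ₑ)
  exact ge_of_tendsto hlim (eventually_mem_nhdsWithin.mono fun η hη ↦ key hη)

theorem lintegral_Ioo_ofReal_rpow_neg {r a : ℝ} (hr : r < 1) (ha : 0 ≤ a) :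
    ∫⁻ t in Ioo 0 a, ENNReal.ofReal (t ^ (-r)) = ENNReal.ofReal (1 / (1 - r) * a ^ (1 - r)) := by
  have hint : IntervalIntegrable (fun t : ℝ ↦ t ^ (-r)) volume 0 a :=
    intervalIntegral.intervalIntegrable_rpow' (by linarith)
  rw [setLIntegral_congr Ioo_ae_eq_Ioc, ← ofReal_integral_eq_lintegral_ofReal
      ((intervalIntegrable_iff_integrableOn_Ioc_of_le ha).1 hint)
      ((ae_restrict_mem measurableSet_Ioc).mono fun t ht ↦ Real.rpow_nonneg ht.1.le _),
    ← intervalIntegral.integral_of_le ha, integral_rpow (.inl (by linarith)),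
    Real.zero_rpow (by linarith)]
  congr 1
  rw [neg_add_eq_sub]
  ring

theorem lintegral_rpow_mul_rearrangement_le {Ω : Type*} [MeasurableSpace Ω] {μ : Measure Ω}
    {u : Ω → ℝ} (hu_top : ∀ s > 0, μ {x | s < |u x|} ≠ ∞) {r : ℝ} (hr : r < 1) :
    ∫⁻ t in Ioi (0 : ℝ), ENNReal.ofReal (t ^ (-r)) * rearrangement μ u t ≤
      ENNReal.ofReal (1 / (1 - r)) * ∫⁻ s in Ioi (0 : ℝ), μ {x | s < |u x|} ^ (1 - r) := by
  have hα := (antitone_measure_lt_abs μ u).measurable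
  set S : Set (ℝ × ℝ) := {z | ENNReal.ofReal z.1 < μ {x | z.2 < |u x|}}
  have hSm : MeasurableSet S := measurableSet_lt (by fun_prop) (hα.comp measurable_snd)
  have hSind : Measurable (S.indicator (1 : ℝ × ℝ → ℝ≥0∞)) := measurable_one.indicator hSm
  have hrearr (t : ℝ) : rearrangement μ u t ≤
      ∫⁻ s in Ioi (0 : ℝ), S.indicator 1 (t, s) := by
    have hSt : MeasurableSet (Prod.mk t ⁻¹' S) := measurable_prodMk_left hSm
    have : (fun s ↦ S.indicator (1 : ℝ × ℝ → ℝ≥0∞) (t, s)) = (Prod.mk t ⁻¹' S).indicator 1 := rfl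
    rw [this, lintegral_indicator_one hSt]
    nth_rw 1 [eq_volume_restrict_ofReal_lt (rearrangement μ u t)]
    refine measure_mono_ae ((ae_restrict_mem measurableSet_Ioi).mono fun s hs hst ↦ ?_)
    by_contra hS'
    exact absurd (show rearrangement μ u t ≤ _ from
      sInf_le (mem_image_of_mem _ ⟨hs, not_lt.1 hS'⟩)) (not_le.2 hst)
  calc ∫⁻ t in Ioi (0 : ℝ), ENNReal.ofReal (t ^ (-r)) * rearrangement μ u t
      ≤ ∫⁻ t in Ioi (0 : ℝ), ∫⁻ s in Ioi (0 : ℝ),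
          ENNReal.ofReal (t ^ (-r)) * S.indicator 1 (t, s) := by
        refine lintegral_mono fun t ↦ ?_
        have hSt : Measurable fun s ↦ S.indicator (1 : ℝ × ℝ → ℝ≥0∞) (t, s) :=
          hSind.comp measurable_prodMk_left
        rw [lintegral_const_mul _ hSt]
        gcongr
        exact hrearr t
    _ = ∫⁻ s in Ioi (0 : ℝ), ∫⁻ t in Ioi (0 : ℝ),
          ENNReal.ofReal (t ^ (-r)) * S.indicator 1 (t, s) := by
        refine lintegral_lintegral_swap (Measurable.aemeasurable ?_)
        exact Measurable.mul (by fun_prop) hSind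
    _ = ∫⁻ s in Ioi (0 : ℝ), ENNReal.ofReal (1 / (1 - r)) * μ {x | s < |u x|} ^ (1 - r) := by
        refine setLIntegral_congr_fun measurableSet_Ioi fun s hs ↦ ?_
        set a := (μ {x | s < |u x|}).toReal
        have hα_eq : μ {x | s < |u x|} = ENNReal.ofReal a :=
          (ENNReal.ofReal_toReal (hu_top s hs)).symm
        have ha₀ : 0 ≤ a := ENNReal.toReal_nonneg
        have hind : ∀ t ∈ Ioi (0 : ℝ), ENNReal.ofReal (t ^ (-r)) * S.indicator 1 (t, s) =
            (Iio a).indicator (fun t ↦ ENNReal.ofReal (t ^ (-r))) t := by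
          intro t ht
          have hiff : (t, s) ∈ S ↔ t ∈ Iio a :=
            ENNReal.ofReal_lt_iff_lt_toReal (le_of_lt ht) (hu_top s hs)
          simp only [indicator_apply, hiff]
          split_ifs <;> simp
        rw [setLIntegral_congr_fun measurableSet_Ioi hind, lintegral_indicator measurableSet_Iio,
          Measure.restrict_restrict measurableSet_Iio, Iio_inter_Ioi,
          lintegral_Ioo_ofReal_rpow_neg hr ha₀, ENNReal.ofReal_mul (by
            rw [one_div, inv_nonneg]; linarith), hα_eq,
          ENNReal.ofReal_rpow_of_nonneg ha₀ (by linarith)]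
    _ = _ := lintegral_const_mul _ (hα.pow_const _)

/-- **Sobolev inequality in the Lorentz space `L^{N/(N-1),1}`** with best constant
`γ = 1/((N-1) ω_N^{1/N})`: for every `u ∈ C_c^∞(ℝ^N)`,
`∫_0^∞ t^{-1/N} u*(t) dt ≤ γ ∫ ‖∇u‖`. -/
theorem lorentz_sobolev_inequality (N : ℕ) (hN : 2 ≤ N)
    (u : EuclideanSpace ℝ (Fin N) → ℝ) (hu : ContDiff ℝ (⊤ : ℕ∞) u) (hsupp : HasCompactSupport u) :
    ∫⁻ t in Set.Ioi (0 : ℝ),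
        ENNReal.ofReal (t ^ (-(1 : ℝ) / N)) * rearrangement volume u t ≤
      ENNReal.ofReal
        ((1 / ((N - 1) *
          (volume (Metric.ball (0 : EuclideanSpace ℝ (Fin N)) 1)).toReal ^ ((1 : ℝ) / N))) *
        ∫ x : EuclideanSpace ℝ (Fin N), ‖gradient u x‖) := by
  have hu₁ : ContDiff ℝ 1 u := hu.of_le (by norm_cast)
  set ω := (volume (Metric.ball (0 : EuclideanSpace ℝ (Fin N)) 1)).toReal with hω
  have hω₀ : 0 < ω :=
    ENNReal.toReal_pos (Metric.measure_ball_pos _ _ one_pos).ne' measure_ball_lt_top.ne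
  have hN₁ : (1 : ℝ) < N := by exact_mod_cast hN
  have hN₂ : (0 : ℝ) < N - 1 := by linarith
  have hgrad : ENNReal.ofReal (∫ x, ‖gradient u x‖) = ∫⁻ x, ‖fderiv ℝ u x‖ₑ := by
    simp only [gradient, LinearIsometryEquiv.norm_map]
    exact ofReal_integral_norm_eq_lintegral_enorm
      ((hu₁.continuous_fderiv one_ne_zero).integrable_of_hasCompactSupport (hsupp.fderiv ℝ))
  have hconst : 1 / (1 - (1 : ℝ) / N) =
      1 / ((N - 1) * ω ^ ((1 : ℝ) / N)) * (N * ω ^ ((1 : ℝ) / N)) := by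
    have : ω ^ ((1 : ℝ) / N) ≠ 0 := by positivity
    field_simp
  rw [ENNReal.ofReal_mul (by positivity), hgrad]
  calc _ ≤ _ := by
        simpa only [neg_div] using lintegral_rpow_mul_rearrangement_le
          (fun s hs ↦ hsupp.measure_lt_abs_ne_top hs) ((div_lt_one (by linarith)).2 hN₁)
    _ = ENNReal.ofReal (1 / ((N - 1) * ω ^ ((1 : ℝ) / N))) *
        (ENNReal.ofReal (N * ω ^ ((1 : ℝ) / N)) *
          ∫⁻ s in Ioi (0 : ℝ), volume {x | s < |u x|} ^ (1 - (1 : ℝ) / N)) := by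
        rw [hconst, ENNReal.ofReal_mul (by positivity), mul_assoc]
    _ ≤ _ := by
        gcongr
        exact mul_lintegral_measure_rpow_le_lintegral_fderiv hN hu₁ hsupp
end

section
/- Let N ≥ 2 be an integer, 1 < p, a > 0, and define u_p : ℝ^N → ℝ by u_p(x) = (a/(N−1))^{1/(p−1)} (1 − ‖x‖). Then u_p is differentiable on ℝ^N \ {0} with ∇u_p(x) = −(a/(N−1))^{1/(p−1)} x/‖x‖, for every x ≠ 0 one has ‖∇u_p(x)‖^{p−2} ∇u_p(x) = −(a/(N−1)) x/‖x‖, and for every φ ∈ C_c^∞(B_1(0)), ∫_{B_1(0)} ‖∇u_p(x)‖^{p−2} ⟨∇u_p(x), ∇φ(x)⟩ dx = a ∫_{B_1(0)} φ(x)/‖x‖ dx; that is, u_p is a weak solution of −Δ_p u = a/‖x‖ in B_1(0) with u = 0 on ∂B_1(0). -/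
open MeasureTheory RealInnerProductSpace

section

variable {E : Type*} [NormedAddCommGroup E] [InnerProductSpace ℝ E]

theorem hasGradientAt_norm [CompleteSpace E] {x : E} (hx : x ≠ 0) :
    HasGradientAt (fun y : E => ‖y‖) (‖x‖⁻¹ • x) x := by
  rw [hasGradientAt_iff_hasFDerivAt]
  have h := (hasStrictFDerivAt_norm_sq x).hasFDerivAt.sqrt (pow_ne_zero 2 (norm_ne_zero_iff.2 hx))
  simp only [Real.sqrt_sq (norm_nonneg _)] at h
  refine h.congr_fderiv ?_
  ext y
  have : ‖x‖ ≠ 0 := norm_ne_zero_iff.2 hx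
  simp only [one_div, mul_inv_rev, smul_apply, innerSL_apply_apply,
    nsmul_eq_mul, Nat.cast_ofNat, smul_eq_mul, map_smul, InnerProductSpace.toDual_apply_apply]
  field_simp

variable [FiniteDimensional ℝ E] [MeasurableSpace E] [BorelSpace E]

theorem integrable_div_norm_of_hasCompactSupport (hd : 2 ≤ Module.finrank ℝ E) {φ : E → ℝ}
    (hφ : Continuous φ) (hc : HasCompactSupport φ) (μ : Measure E) [μ.IsAddHaarMeasure] :
    Integrable (fun x => φ x / ‖x‖) μ := by
  obtain ⟨R, hR⟩ := hc.isCompact.isBounded.subset_ball 0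
  obtain ⟨C, hC⟩ := hc.exists_bound_of_continuous hφ
  have hmeas : Measurable fun x => φ x / ‖x‖ := hφ.measurable.div measurable_norm
  have hd' : (1 : ℝ) < Module.finrank ℝ E := by exact_mod_cast hd
  have h : IntegrableOn (fun x => φ x / ‖x‖) (Metric.ball 0 R) μ := by
    refine integrableOn_ball_of_norm_le_rpow (C := C) (by lia) hd'
      (Filter.Eventually.of_forall fun x => ?_) hmeas.aestronglyMeasurable
    rw [Real.rpow_neg_one, norm_div, norm_norm, div_eq_mul_inv]
    gcongr
    exact hC x
  refine (integrableOn_iff_integrable_of_support_subset fun x hx => hR (subset_tsupport φ ?_)).1 h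
  contrapose! hx
  simp_all

/-- Both sides are the derivative at `t = 1` of `t ↦ ∫ φ (t • x) / ‖x‖ ∂μ`. -/
theorem integral_fderiv_self_div_norm (hd : 2 ≤ Module.finrank ℝ E) {φ : E → ℝ}
    (hφ : ContDiff ℝ 1 φ) (hc : HasCompactSupport φ) (μ : Measure E) [μ.IsAddHaarMeasure] :
    ∫ x, fderiv ℝ φ x x / ‖x‖ ∂μ = -((Module.finrank ℝ E : ℝ) - 1) * ∫ x, φ x / ‖x‖ ∂μ := by
  obtain ⟨R, hR⟩ := hc.isCompact.isBounded.subset_ball 0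
  have hφ' : Continuous (fderiv ℝ φ) := hφ.continuous_fderiv one_ne_zero
  obtain ⟨C, hC⟩ := (hc.fderiv (𝕜 := ℝ)).exists_bound_of_continuous hφ'
  have hC0 : 0 ≤ C := (norm_nonneg _).trans (hC 0)
  have hs : Set.Ioi (1 / 2 : ℝ) ∈ nhds (1 : ℝ) := Ioi_mem_nhds (by norm_num)
  have hderiv := (hasDerivAt_integral_of_dominated_loc_of_deriv_le (μ := μ) hs
    (F := fun t x => φ (t • x) / ‖x‖) (F' := fun t x => fderiv ℝ φ (t • x) x / ‖x‖)
    (bound := (Metric.ball (0 : E) (2 * R)).indicator fun _ => C)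
    (Filter.Eventually.of_forall fun t =>
      ((hφ.continuous.comp (continuous_const_smul t)).measurable.div
        measurable_norm).aestronglyMeasurable)
    (by simpa using integrable_div_norm_of_hasCompactSupport hd hφ.continuous hc μ)
    (Measurable.aestronglyMeasurable (by
      refine Measurable.div (Continuous.measurable ?_) measurable_norm
      exact (hφ'.comp (continuous_const_smul _)).clm_apply continuous_id))
    (Filter.Eventually.of_forall fun x t ht => by
      have ht' : (1 / 2 : ℝ) < t := ht
      by_cases hx : x ∈ Metric.ball (0 : E) (2 * R)
      · rw [Set.indicator_of_mem hx, norm_div, norm_norm]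
        refine div_le_of_le_mul₀ (norm_nonneg _) hC0 ((ContinuousLinearMap.le_opNorm _ _).trans ?_)
        gcongr
        exact hC _
      · have : t • x ∉ tsupport φ := fun h => hx <| by
          have h1 := mem_ball_zero_iff.1 (hR h)
          rw [norm_smul, Real.norm_of_nonneg (by linarith)] at h1
          rw [mem_ball_zero_iff]
          nlinarith [norm_nonneg x]
        rw [Set.indicator_of_notMem hx,
          image_eq_zero_of_notMem_tsupport fun h => this (tsupport_fderiv_subset ℝ h)]
        simp)
    ((integrable_indicator_iff measurableSet_ball).2
      (integrableOn_const measure_ball_lt_top.ne))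
    (Filter.Eventually.of_forall fun x t _ => by
      have h1 : HasDerivAt (fun s : ℝ => s • x) x t := by
        simpa using (hasDerivAt_id t).smul_const x
      exact (((hφ.differentiable one_ne_zero _).hasFDerivAt).comp_hasDerivAt t h1).div_const _)).2
  simp only [one_smul] at hderiv
  set d := Module.finrank ℝ E
  have hscale : (fun t : ℝ => ∫ x, φ (t • x) / ‖x‖ ∂μ) =ᶠ[nhds 1]
      fun t => (t ^ (d - 1))⁻¹ * ∫ x, φ x / ‖x‖ ∂μ := by
    filter_upwards [Ioi_mem_nhds (zero_lt_one (α := ℝ))] with t ht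
    have ht : 0 < t := ht
    have h := Measure.integral_comp_smul_of_nonneg μ (fun x => φ x / ‖x‖) t (hR := ht.le)
    have h2 : ∀ x, φ (t • x) / ‖x‖ = t * (φ (t • x) / ‖t • x‖) := fun x => by
      rw [norm_smul, Real.norm_of_nonneg ht.le, ← mul_div_assoc, mul_div_mul_left _ _ ht.ne']
    simp_rw [h2]
    rw [integral_const_mul, h, smul_eq_mul, ← mul_assoc]
    congr 1
    rw [show Module.finrank ℝ E = (d - 1) + 1 by lia, pow_succ]
    field_simp
  have hpow : HasDerivAt (fun t : ℝ => (t ^ (d - 1))⁻¹ * ∫ x, φ x / ‖x‖ ∂μ)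
      (-((d : ℝ) - 1) * ∫ x, φ x / ‖x‖ ∂μ) 1 := by
    have h := ((hasDerivAt_pow (d - 1) (1 : ℝ)).inv (by simp)).mul_const (∫ x, φ x / ‖x‖ ∂μ)
    simpa [Nat.cast_sub (show 1 ≤ d by lia)] using h
  exact hderiv.unique (hpow.congr_of_eventuallyEq hscale)

end

/-- The explicit function `u_p(x) = (a/(N-1))^{1/(p-1)} (1 - ‖x‖)` has gradient
`-(a/(N-1))^{1/(p-1)} x/‖x‖` away from the origin, satisfies
`‖∇u_p‖^{p-2} ∇u_p = -(a/(N-1)) x/‖x‖` there, and is a weak solution of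
`-Δ_p u = a/‖x‖` in `B_1(0)` with `u = 0` on `∂B_1(0)`. -/
theorem hardy_explicit_solution (N : ℕ) (hN : 2 ≤ N) (p a : ℝ) (hp : 1 < p) (ha : 0 < a)
    (u : EuclideanSpace ℝ (Fin N) → ℝ)
    (hu : ∀ x : EuclideanSpace ℝ (Fin N),
      u x = (a / (N - 1)) ^ (1 / (p - 1)) * (1 - ‖x‖)) :
    (∀ x : EuclideanSpace ℝ (Fin N), x ≠ 0 →
      HasGradientAt u ((-(a / (N - 1)) ^ (1 / (p - 1)) : ℝ) • (‖x‖⁻¹ • x)) x) ∧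
    (∀ x : EuclideanSpace ℝ (Fin N), x ≠ 0 →
      ‖gradient u x‖ ^ (p - 2) • gradient u x = (-(a / (N - 1)) : ℝ) • (‖x‖⁻¹ • x)) ∧
    (∀ φ : EuclideanSpace ℝ (Fin N) → ℝ, ContDiff ℝ (⊤ : ℕ∞) φ → HasCompactSupport φ →
      tsupport φ ⊆ Metric.ball (0 : EuclideanSpace ℝ (Fin N)) 1 →
      ∫ x in Metric.ball (0 : EuclideanSpace ℝ (Fin N)) 1,
          ‖gradient u x‖ ^ (p - 2) * ⟪gradient u x, gradient φ x⟫ =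
        a * ∫ x in Metric.ball (0 : EuclideanSpace ℝ (Fin N)) 1, φ x / ‖x‖) := by
  have hN' : (0 : ℝ) < N - 1 := by
    have : (2 : ℝ) ≤ N := by exact_mod_cast hN
    linarith
  have hb : 0 < a / ((N : ℝ) - 1) := div_pos ha hN'
  obtain rfl : u = fun x => (a / (N - 1)) ^ (1 / (p - 1)) * (1 - ‖x‖) := funext hu
  generalize hbdef : a / ((N : ℝ) - 1) = b at *
  have hgrad : ∀ x : EuclideanSpace ℝ (Fin N), x ≠ 0 →
      HasGradientAt (fun x => b ^ (1 / (p - 1)) * (1 - ‖x‖))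
        ((-b ^ (1 / (p - 1)) : ℝ) • (‖x‖⁻¹ • x)) x := fun x hx => by
    rw [hasGradientAt_iff_hasFDerivAt]
    have h := (((hasGradientAt_norm hx).hasFDerivAt).const_sub 1).const_mul (b ^ (1 / (p - 1)))
    refine h.congr_fderiv ?_
    simp
  have hflux : ∀ x : EuclideanSpace ℝ (Fin N), x ≠ 0 →
      ‖gradient (fun x : EuclideanSpace ℝ (Fin N) => b ^ (1 / (p - 1)) * (1 - ‖x‖)) x‖ ^ (p - 2) •
        gradient (fun x : EuclideanSpace ℝ (Fin N) => b ^ (1 / (p - 1)) * (1 - ‖x‖)) x =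
        (-b : ℝ) • (‖x‖⁻¹ • x) := fun x hx => by
    have hc : 0 < b ^ (1 / (p - 1)) := Real.rpow_pos_of_pos hb _
    rw [(hgrad x hx).gradient, norm_smul, norm_smul, norm_inv, norm_norm,
      inv_mul_cancel₀ (norm_ne_zero_iff.2 hx), mul_one, norm_neg, Real.norm_of_nonneg hc.le,
      smul_smul, mul_neg, ← Real.rpow_add_one hc.ne', ← Real.rpow_mul hb.le]
    have : 1 / (p - 1) * (p - 2 + 1) = 1 := by
      have : p - 1 ≠ 0 := by linarith
      field_simp
      ring
    rw [this, Real.rpow_one]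
  refine ⟨hgrad, hflux, fun φ hφ hc hsupp => ?_⟩
  have hfin : Module.finrank ℝ (EuclideanSpace ℝ (Fin N)) = N := finrank_euclideanSpace_fin
  have : Nontrivial (EuclideanSpace ℝ (Fin N)) :=
    Module.nontrivial_of_finrank_pos (R := ℝ) (zero_lt_two.trans_le (hN.trans_eq hfin.symm))
  have hmain := integral_fderiv_self_div_norm (hN.trans_eq hfin.symm)
    (hφ.of_le (by exact_mod_cast le_top)) hc (volume : Measure (EuclideanSpace ℝ (Fin N)))
  have hzero : ∀ x ∉ Metric.ball (0 : EuclideanSpace ℝ (Fin N)) 1, x ∉ tsupport φ :=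
    fun x hx h => hx (hsupp h)
  rw [setIntegral_congr_ae₀ (g := fun x => -b * (fderiv ℝ φ x x / ‖x‖))
      measurableSet_ball.nullMeasurableSet, integral_const_mul,
    setIntegral_eq_integral_of_forall_compl_eq_zero,
    setIntegral_eq_integral_of_forall_compl_eq_zero,
    hmain, hfin, ← hbdef]
  · field_simp
  · intro x hx
    simp [image_eq_zero_of_notMem_tsupport (hzero x hx)]
  · intro x hx
    rw [image_eq_zero_of_notMem_tsupport fun h => hzero x hx (tsupport_fderiv_subset ℝ h)]
    simp
  · filter_upwards [Measure.ae_ne volume (0 : EuclideanSpace ℝ (Fin N))] with x hx _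
    rw [← real_inner_smul_left, hflux x hx, real_inner_smul_left, real_inner_smul_left,
      inner_gradient_right]
    simp [div_eq_inv_mul]
end

section
/- Let N ≥ 2 be an integer and 0 < α < N−1. Define u(x) = ‖x‖^{−α} − 1 and G(x) = −α ‖x‖^{−α−2} x for x ∈ B_1(0) \ {0}. Then: (i) u and G are Lebesgue integrable on B_1(0); (ii) G is the distributional gradient of u on B_1(0), i.e. for every φ ∈ C_c^∞(B_1(0)), ∫_{B_1(0)} u(x) ∇φ(x) dx = −∫_{B_1(0)} φ(x) G(x) dx (as vectors in ℝ^N); (iii) the bounded vector field z(x) = −x/‖x‖ satisfies ⟨z(x), G(x)⟩ = ‖G(x)‖ for every x ≠ 0. -/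
open MeasureTheory RealInnerProductSpace

open Filter Topology Metric

section Norm

variable {E : Type*} [NormedAddCommGroup E]

lemma rpow_norm_sq_add_le {a : ℝ} (ha : a ≤ 0) {ε : ℝ} (hε : 0 < ε) {x : E} (hx : x ≠ 0) :
    (‖x‖ ^ 2 + ε) ^ a ≤ ‖x‖ ^ (2 * a) := by
  have hx' : 0 < ‖x‖ := norm_pos_iff.2 hx
  rw [Real.rpow_mul hx'.le, Real.rpow_two]
  exact Real.rpow_le_rpow_of_nonpos (by positivity) (by linarith) ha

lemma tendsto_rpow_norm_sq_add (a : ℝ) {x : E} (hx : x ≠ 0) :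
    Tendsto (fun ε : ℝ => (‖x‖ ^ 2 + ε) ^ a) (𝓝[>] 0) (𝓝 (‖x‖ ^ (2 * a))) := by
  have hx' : 0 < ‖x‖ := norm_pos_iff.2 hx
  have h : ContinuousAt (fun ε : ℝ => (‖x‖ ^ 2 + ε) ^ a) 0 :=
    (by fun_prop : ContinuousAt (fun ε : ℝ => ‖x‖ ^ 2 + ε) 0).rpow_const
      (Or.inl (by simp [hx]))
  have h' := h.tendsto.mono_left (nhdsWithin_le_nhds (s := Set.Ioi 0))
  rw [Real.rpow_mul hx'.le, Real.rpow_two]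
  rwa [add_zero] at h'

lemma norm_rpow_neg_sub_two_mul_norm (p : ℝ) {x : E} (hx : x ≠ 0) :
    ‖x‖ ^ (-p - 2) * ‖x‖ = ‖x‖ ^ (-(p + 1)) := by
  rw [← Real.rpow_add_one (norm_ne_zero_iff.2 hx)]
  congr 1
  ring

end Norm

section Gradient

variable {E : Type*} [NormedAddCommGroup E] [InnerProductSpace ℝ E]

lemma contDiff_rpow_norm_sq_add (a : ℝ) {ε : ℝ} (hε : 0 < ε) :
    ContDiff ℝ 1 (fun x : E => (‖x‖ ^ 2 + ε) ^ a - 1) :=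
  (((contDiff_norm_sq ℝ).add contDiff_const).rpow_const_of_ne
    (fun x => by positivity)).sub contDiff_const

variable [CompleteSpace E]

lemma continuous_gradient_of_contDiff {f : E → ℝ} (hf : ContDiff ℝ 1 f) :
    Continuous (gradient f) :=
  (InnerProductSpace.toDual ℝ E).symm.continuous.comp (hf.continuous_fderiv one_ne_zero)

lemma tsupport_gradient_subset (f : E → ℝ) : tsupport (gradient f) ⊆ tsupport f := by
  refine (closure_mono fun x hx => ?_).trans (tsupport_fderiv_subset ℝ (f := f))
  simp only [Function.mem_support, gradient] at hx ⊢
  exact fun h => hx (by rw [h, map_zero])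

lemma hasGradientAt_rpow_norm_sq_add (a : ℝ) {ε : ℝ} (hε : 0 < ε) (x : E) :
    HasGradientAt (fun x : E => (‖x‖ ^ 2 + ε) ^ a - 1)
      ((2 * a * (‖x‖ ^ 2 + ε) ^ (a - 1)) • x) x := by
  have h := (((hasStrictFDerivAt_norm_sq x).hasFDerivAt.add_const ε).rpow_const (p := a)
    (Or.inl (by positivity))).sub_const 1
  rw [hasGradientAt_iff_hasFDerivAt]
  refine h.congr_fderiv (ContinuousLinearMap.ext fun v => ?_)
  simp
  ring

end Gradient

section Integral

variable {E : Type*} [NormedAddCommGroup E] [InnerProductSpace ℝ E] [FiniteDimensional ℝ E]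
  [MeasurableSpace E] [BorelSpace E]

/-- The power `‖x‖ ^ (-p)` is integrable on the unit ball when `p` is below the dimension. -/
lemma integrableOn_ball_norm_rpow_neg [Nontrivial E] {p : ℝ} (hp : p < Module.finrank ℝ E) :
    IntegrableOn (fun x : E => ‖x‖ ^ (-p)) (ball (0 : E) 1) := by
  rw [integrableOn_fun_norm_addHaar volume (f := fun y => y ^ (-p))]
  have h1 : 1 ≤ Module.finrank ℝ E := Module.finrank_pos
  have h : IntegrableOn (fun y : ℝ => y ^ ((Module.finrank ℝ E : ℝ) - 1 - p)) (Set.Ioo 0 1) := by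
    rw [intervalIntegral.integrableOn_Ioo_rpow_iff one_pos]
    linarith
  refine h.congr_fun (fun y hy => ?_) measurableSet_Ioo
  simp only [smul_eq_mul]
  rw [← Real.rpow_natCast, ← Real.rpow_add hy.1, Nat.cast_sub h1, Nat.cast_one, sub_eq_add_neg _ p]

/-- Integration by parts for gradients of `C¹` functions, one of them compactly supported. -/
lemma integral_smul_gradient_eq_neg {f φ : E → ℝ} (hf : ContDiff ℝ 1 f) (hφ : ContDiff ℝ 1 φ)
    (hc : HasCompactSupport φ) :
    ∫ x, f x • gradient φ x = -∫ x, φ x • gradient f x := by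
  have hcg : HasCompactSupport (gradient φ) :=
    hc.mono' (subset_closure.trans (tsupport_gradient_subset φ))
  have i1 : Integrable (fun x => f x • gradient φ x) :=
    (hf.continuous.smul (continuous_gradient_of_contDiff hφ)).integrable_of_hasCompactSupport
      hcg.smul_left
  have i2 : Integrable (fun x => φ x • gradient f x) :=
    (hφ.continuous.smul (continuous_gradient_of_contDiff hf)).integrable_of_hasCompactSupport
      hc.smul_right
  have i3 : Integrable (fun x => f x * φ x) :=
    (hf.continuous.mul hφ.continuous).integrable_of_hasCompactSupport hc.mul_left
  refine ext_inner_left ℝ fun v => ?_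
  have e1 : ∀ x, ⟪v, f x • gradient φ x⟫ = f x * fderiv ℝ φ x v := fun x => by
    rw [inner_smul_right, real_inner_comm, inner_gradient_left]
  have e2 : ∀ x, ⟪v, φ x • gradient f x⟫ = fderiv ℝ f x v * φ x := fun x => by
    rw [inner_smul_right, real_inner_comm, inner_gradient_left, mul_comm]
  rw [inner_neg_right, ← integral_inner i1, ← integral_inner i2]
  have j1 := i1.const_inner (𝕜 := ℝ) v
  have j2 := i2.const_inner (𝕜 := ℝ) v
  simp only [e1, e2] at j1 j2 ⊢
  exact integral_mul_fderiv_eq_neg_fderiv_mul_of_integrable j2 j1 i3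
    (fun x _ => hf.differentiable one_ne_zero x) (fun x _ => hφ.differentiable one_ne_zero x)

/-- On the unit ball, `-α ‖x‖ ^ (-α - 2) x` is the distributional gradient of `‖x‖ ^ (-α) - 1`. -/
lemma integral_norm_rpow_smul_gradient [Nontrivial E] {α : ℝ} (hα0 : 0 < α)
    (hα : α + 1 < Module.finrank ℝ E) {φ : E → ℝ} (hφ : ContDiff ℝ 1 φ)
    (hc : HasCompactSupport φ) (hs : tsupport φ ⊆ ball (0 : E) 1) :
    ∫ x in ball (0 : E) 1, (‖x‖ ^ (-α) - 1) • gradient φ x =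
      -∫ x in ball (0 : E) 1, φ x • ((-α * ‖x‖ ^ (-α - 2)) • x) := by
  have hcg : HasCompactSupport (gradient φ) :=
    hc.mono' (subset_closure.trans (tsupport_gradient_subset φ))
  have hgc := continuous_gradient_of_contDiff hφ
  obtain ⟨C, hC⟩ := hcg.exists_bound_of_continuous hgc
  obtain ⟨D, hD⟩ := hc.exists_bound_of_continuous hφ.continuous
  have hne : ∀ᵐ x ∂(volume.restrict (ball (0 : E) 1)), x ≠ 0 :=
    ae_restrict_of_ae (Measure.ae_ne volume 0)
  have hi : IntegrableOn (fun x : E => ‖x‖ ^ (-α)) (ball (0 : E) 1) :=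
    integrableOn_ball_norm_rpow_neg (by linarith)
  have hi' : IntegrableOn (fun x : E => ‖x‖ ^ (-(α + 1))) (ball (0 : E) 1) :=
    integrableOn_ball_norm_rpow_neg hα
  let f : ℝ → E → ℝ := fun ε x => (‖x‖ ^ 2 + ε) ^ (-α / 2) - 1
  have hf : ∀ ε > 0, ContDiff ℝ 1 (f ε) := fun ε hε => contDiff_rpow_norm_sq_add _ hε
  have hgrad : ∀ ε > 0, ∀ x, gradient (f ε) x = (-α * (‖x‖ ^ 2 + ε) ^ (-α / 2 - 1)) • x := by
    intro ε hε x
    rw [(hasGradientAt_rpow_norm_sq_add (-α / 2) hε x).gradient]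
    congr 2
    ring
  have lim1 : Tendsto (fun ε => ∫ x in ball (0 : E) 1, f ε x • gradient φ x) (𝓝[>] 0)
      (𝓝 (∫ x in ball (0 : E) 1, (‖x‖ ^ (-α) - 1) • gradient φ x)) := by
    refine tendsto_integral_filter_of_dominated_convergence (fun x => (‖x‖ ^ (-α) + 1) * C) ?_ ?_
      ((hi.add (integrableOn_const (by finiteness))).mul_const C) ?_
    · filter_upwards [self_mem_nhdsWithin] with ε hε
      exact ((hf ε hε).continuous.smul hgc).aestronglyMeasurable
    · filter_upwards [self_mem_nhdsWithin] with ε hε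
      filter_upwards [hne] with x hx
      rw [norm_smul]
      have h := rpow_norm_sq_add_le (a := -α / 2) (by linarith) hε hx
      rw [mul_div_cancel₀ _ two_ne_zero] at h
      have h0 : 0 ≤ (‖x‖ ^ 2 + ε) ^ (-α / 2) :=
        Real.rpow_nonneg (add_nonneg (sq_nonneg _) (le_of_lt hε)) _
      have : ‖f ε x‖ ≤ ‖x‖ ^ (-α) + 1 := by
        rw [Real.norm_eq_abs, abs_le]
        constructor <;> simp only [f] <;> linarith
      exact mul_le_mul this (hC x) (norm_nonneg _) (by linarith)
    · filter_upwards [hne] with x hx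
      have h := tendsto_rpow_norm_sq_add (-α / 2) hx
      rw [mul_div_cancel₀ _ two_ne_zero] at h
      exact (h.sub_const 1).smul_const _
  have lim2 : Tendsto (fun ε => ∫ x in ball (0 : E) 1, φ x • gradient (f ε) x) (𝓝[>] 0)
      (𝓝 (∫ x in ball (0 : E) 1, φ x • ((-α * ‖x‖ ^ (-α - 2)) • x))) := by
    refine tendsto_integral_filter_of_dominated_convergence
      (fun x => D * (α * ‖x‖ ^ (-(α + 1)))) ?_ ?_ ((hi'.const_mul α).const_mul D) ?_
    · filter_upwards [self_mem_nhdsWithin] with ε hε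
      exact (hφ.continuous.smul (continuous_gradient_of_contDiff (hf ε hε))).aestronglyMeasurable
    · filter_upwards [self_mem_nhdsWithin] with ε hε
      filter_upwards [hne] with x hx
      have h := rpow_norm_sq_add_le (a := -α / 2 - 1) (by linarith) hε hx
      rw [show 2 * (-α / 2 - 1) = -α - 2 by ring] at h
      have h0 : 0 ≤ (‖x‖ ^ 2 + ε) ^ (-α / 2 - 1) :=
        Real.rpow_nonneg (add_nonneg (sq_nonneg _) (le_of_lt hε)) _
      rw [norm_smul, hgrad ε hε, norm_smul, norm_mul, norm_neg, Real.norm_of_nonneg hα0.le,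
        Real.norm_of_nonneg h0, ← norm_rpow_neg_sub_two_mul_norm α hx, mul_assoc]
      have hD0 : 0 ≤ D := (norm_nonneg _).trans (hD x)
      gcongr
      exact hD x
    · filter_upwards [hne] with x hx
      have h := tendsto_rpow_norm_sq_add (-α / 2 - 1) hx
      rw [show 2 * (-α / 2 - 1) = -α - 2 by ring] at h
      refine (((h.const_mul (-α)).smul_const x).const_smul (φ x)).congr' ?_
      filter_upwards [self_mem_nhdsWithin] with ε hε
      rw [hgrad ε hε]
  refine tendsto_nhds_unique (lim1.congr' ?_) lim2.neg
  filter_upwards [self_mem_nhdsWithin] with ε hε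
  rw [setIntegral_eq_integral_of_forall_compl_eq_zero,
    setIntegral_eq_integral_of_forall_compl_eq_zero]
  · exact integral_smul_gradient_eq_neg (hf ε hε) hφ hc
  · intro x hx
    rw [image_eq_zero_of_notMem_tsupport fun h => hx (hs h), zero_smul]
  · intro x hx
    rw [image_eq_zero_of_notMem_tsupport fun h => hx (hs (tsupport_gradient_subset φ h)), smul_zero]

end Integral

/-- For `0 < α < N-1`, the function `u(x) = ‖x‖^{-α} - 1` with
`G(x) = -α ‖x‖^{-α-2} x` on `B_1(0) \ {0}` satisfies:
(i) `u` and `G` are integrable on `B_1(0)`;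
(ii) `G` is the distributional gradient of `u` on `B_1(0)`;
(iii) the bounded vector field `z(x) = -x/‖x‖` satisfies `⟨z(x), G(x)⟩ = ‖G(x)‖` for `x ≠ 0`. -/
theorem extreme_case_unbounded_solution (N : ℕ) (hN : 2 ≤ N) (α : ℝ)
    (hα0 : 0 < α) (hα : α < N - 1)
    (u : EuclideanSpace ℝ (Fin N) → ℝ) (G : EuclideanSpace ℝ (Fin N) → EuclideanSpace ℝ (Fin N))
    (hu : ∀ x : EuclideanSpace ℝ (Fin N), x ≠ 0 → u x = ‖x‖ ^ (-α) - 1)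
    (hG : ∀ x : EuclideanSpace ℝ (Fin N), x ≠ 0 → G x = (-α * ‖x‖ ^ (-α - 2)) • x) :
    (IntegrableOn u (Metric.ball (0 : EuclideanSpace ℝ (Fin N)) 1) ∧
      IntegrableOn G (Metric.ball (0 : EuclideanSpace ℝ (Fin N)) 1)) ∧
    (∀ φ : EuclideanSpace ℝ (Fin N) → ℝ, ContDiff ℝ (⊤ : ℕ∞) φ → HasCompactSupport φ →
      tsupport φ ⊆ Metric.ball (0 : EuclideanSpace ℝ (Fin N)) 1 →
      ∫ x in Metric.ball (0 : EuclideanSpace ℝ (Fin N)) 1, u x • gradient φ x =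
        -∫ x in Metric.ball (0 : EuclideanSpace ℝ (Fin N)) 1, φ x • G x) ∧
    (∀ x : EuclideanSpace ℝ (Fin N), x ≠ 0 → ⟪-(‖x‖⁻¹ • x), G x⟫ = ‖G x‖) := by
  have hN' : (2 : ℝ) ≤ N := by exact_mod_cast hN
  have : Nontrivial (EuclideanSpace ℝ (Fin N)) :=
    Module.nontrivial_of_finrank_pos (R := ℝ) (by rw [finrank_euclideanSpace_fin]; omega)
  have hdim : α + 1 < Module.finrank ℝ (EuclideanSpace ℝ (Fin N)) := by
    rw [finrank_euclideanSpace_fin]; linarith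
  have hne : ∀ᵐ x ∂(volume.restrict (ball (0 : EuclideanSpace ℝ (Fin N)) 1)), x ≠ 0 :=
    ae_restrict_of_ae (Measure.ae_ne volume 0)
  have hnorm : ∀ x : EuclideanSpace ℝ (Fin N), x ≠ 0 → ‖G x‖ = α * ‖x‖ ^ (-(α + 1)) := by
    intro x hx
    rw [hG x hx, norm_smul, norm_mul, norm_neg, Real.norm_of_nonneg hα0.le,
      Real.norm_of_nonneg (by positivity), mul_assoc, norm_rpow_neg_sub_two_mul_norm α hx]
  refine ⟨⟨?_, ?_⟩, ?_, ?_⟩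
  · have h : IntegrableOn (fun x : EuclideanSpace ℝ (Fin N) => ‖x‖ ^ (-α) - 1) (ball 0 1) :=
      (integrableOn_ball_norm_rpow_neg (by linarith)).sub (integrableOn_const (by finiteness))
    refine h.congr ?_
    filter_upwards [hne] with x hx using (hu x hx).symm
  · have hmeas : Measurable fun x : EuclideanSpace ℝ (Fin N) => (-α * ‖x‖ ^ (-α - 2)) • x := by
      fun_prop
    refine ((integrableOn_ball_norm_rpow_neg hdim).const_mul α).mono'
      (hmeas.aestronglyMeasurable.congr ?_) ?_
    · filter_upwards [hne] with x hx using (hG x hx).symm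
    · filter_upwards [hne] with x hx using (hnorm x hx).le
  · intro φ hφ hc hs
    have h := integral_norm_rpow_smul_gradient hα0 hdim (hφ.of_le (by simp)) hc hs
    rw [integral_congr_ae (g := fun x => (‖x‖ ^ (-α) - 1) • gradient φ x), h,
      integral_congr_ae (f := fun x => φ x • G x)]
    · filter_upwards [hne] with x hx
      rw [hG x hx]
    · filter_upwards [hne] with x hx
      rw [hu x hx]
  · intro x hx
    have hx' : ‖x‖ ≠ 0 := norm_ne_zero_iff.2 hx
    rw [hnorm x hx, hG x hx, ← norm_rpow_neg_sub_two_mul_norm α hx, inner_neg_left, real_inner_smul_left,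
      real_inner_smul_right, real_inner_self_eq_norm_sq]
    field_simp
end
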